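/- If (X_n)_{n≥1} is a stationary and ergodic process taking values in S with X_1 ~ P, then for every D, almost surely liminf_{n→∞} L_n(X_1^n, Q^n, D) = R(P,Q,D), where Q^n denotes the n-fold product of Q. -/

import Mathlib

open MeasureTheory Filter Set Topology Classical
open scoped ENNReal NNReal

noncomputable section

/-- `-log t` as a value in `ℝ≥0∞` (equal to `∞` when `t = 0`); intended for `t ≤ 1`. -/
def negLog (t : ℝ≥0∞) : ℝ≥0∞ :=
  if t = 0 then ∞ else ENNReal.ofReal (-Real.log t.toReal)

/-- `log t` as a value in `ℝ≥0∞` (equal to `∞` when `t = ∞`); intended for `t ≥ 1`. -/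
def posLog (t : ℝ≥0∞) : ℝ≥0∞ :=
  if t = ∞ then ∞ else ENNReal.ofReal (Real.log t.toReal)

/-- The extended-real-valued logarithm of an `ℝ≥0∞` number. -/
def eLog (t : ℝ≥0∞) : EReal :=
  if t = 0 then ⊥ else if t = ∞ then ⊤ else ((Real.log t.toReal : ℝ) : EReal)

/-- Relative entropy `H(μ‖ν)` (in nats), valued in `ℝ≥0∞`: it equals
`∫ log (dμ/dν) dμ` when `μ ≪ ν` (and `+∞` when this integral is not defined,
which for probability measures can only mean `+∞`), and `+∞` when `¬ μ ≪ ν`. -/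
def relEnt {α : Type*} [MeasurableSpace α] (μ ν : Measure α) : ℝ≥0∞ :=
  if μ ≪ ν ∧ Integrable (llr μ ν) μ then ENNReal.ofReal (∫ x, llr μ ν x ∂μ) else ∞

/-- The set `W(P,D)` of couplings: probability measures on `S × T` with first
marginal `P` and expected distortion at most `D`. -/
def distSet {S T : Type*} [MeasurableSpace S] [MeasurableSpace T]
    (ρ : S × T → ℝ) (P : Measure S) (D : ℝ) : Set (Measure (S × T)) :=
  {W | IsProbabilityMeasure W ∧ W.map Prod.fst = P ∧
    ((∫⁻ z, ENNReal.ofReal (ρ z) ∂W : ℝ≥0∞) : EReal) ≤ ((D : ℝ) : EReal)}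

/-- The rate function `R(P,Q,D) = inf_{W ∈ W(P,D)} H(W‖P×Q)` (equal to `+∞`
when `W(P,D)` is empty). -/
def Rrate {S T : Type*} [MeasurableSpace S] [MeasurableSpace T]
    (ρ : S × T → ℝ) (P : Measure S) (Q : Measure T) (D : ℝ) : ℝ≥0∞ :=
  ⨅ W ∈ distSet ρ P D, relEnt W (P.prod Q)

/-- `Λ(P,Q,λ) = E_X[log E_Y e^{λρ(X,Y)}]`, valued in `EReal`.
For `λ ≥ 0` the integrand lies in `[0,∞]`; for `λ < 0` it lies in `[-∞,0]`. -/
def Lam {S T : Type*} [MeasurableSpace S] [MeasurableSpace T]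
    (ρ : S × T → ℝ) (P : Measure S) (Q : Measure T) (l : ℝ) : EReal :=
  if 0 ≤ l then
    ((∫⁻ x, posLog (∫⁻ y, ENNReal.ofReal (Real.exp (l * ρ (x, y))) ∂Q) ∂P : ℝ≥0∞) : EReal)
  else
    -(((∫⁻ x, negLog (∫⁻ y, ENNReal.ofReal (Real.exp (l * ρ (x, y))) ∂Q) ∂P : ℝ≥0∞) : EReal))

/-- The Fenchel–Legendre transform `Λ*(P,Q,D) = sup_{λ ≤ 0} [λD - Λ(P,Q,λ)]`. -/
def LamStar {S T : Type*} [MeasurableSpace S] [MeasurableSpace T]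
    (ρ : S × T → ℝ) (P : Measure S) (Q : Measure T) (D : ℝ) : EReal :=
  ⨆ l ∈ Iic (0 : ℝ), (((l * D : ℝ) : EReal) - Lam ρ P Q l)

/-- `ρ_Q(x) := essinf_{Y ∼ Q} ρ(x,Y)`. -/
def rhoQ {S T : Type*} [MeasurableSpace T]
    (ρ : S × T → ℝ) (Q : Measure T) (x : S) : ℝ :=
  essInf (fun y => ρ (x, y)) Q

/-- `D_min(P,Q) := inf {D : Λ*(P,Q,D) < ∞}`. -/
def DminPQ {S T : Type*} [MeasurableSpace S] [MeasurableSpace T]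
    (ρ : S × T → ℝ) (P : Measure S) (Q : Measure T) : ℝ :=
  sInf {D : ℝ | LamStar ρ P Q D ≠ ⊤}

/-- `D_ave(P,Q) := E ρ(X,Y)` for independent `X ∼ P`, `Y ∼ Q`, valued in `ℝ≥0∞`. -/
def DavePQ {S T : Type*} [MeasurableSpace S] [MeasurableSpace T]
    (ρ : S × T → ℝ) (P : Measure S) (Q : Measure T) : ℝ≥0∞ :=
  ∫⁻ z, ENNReal.ofReal (ρ z) ∂(P.prod Q)

/-- The candidate derivative `Λ'(λ)` of `Λ(P,Q,·)`. -/
def LamD {S T : Type*} [MeasurableSpace S] [MeasurableSpace T]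
    (ρ : S × T → ℝ) (P : Measure S) (Q : Measure T) (l : ℝ) : ℝ :=
  ∫ x, (∫ y, ρ (x, y) * Real.exp (l * ρ (x, y)) ∂Q) /
    (∫ y, Real.exp (l * ρ (x, y)) ∂Q) ∂P

/-- The left shift on sequences. -/
def shiftSeq {α : Type*} (x : ℕ → α) (n : ℕ) : α := x (n + 1)

/-- The single-letter distortion measure `ρ_n` on `n`-strings. -/
def rhoFin {S T : Type*} (ρ : S × T → ℝ) (n : ℕ) (x : Fin n → S) (y : Fin n → T) : ℝ :=
  (n : ℝ)⁻¹ * ∑ k, ρ (x k, y k)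

/-- `L_n(x_1^n, Q^n, D) = -(1/n) log Q^n(B_n(x_1^n,D))`, valued in `ℝ≥0∞`,
for a memoryless (product) codebook distribution `Q^n`. -/
def LnIID {S T : Type*} [MeasurableSpace T]
    (ρ : S × T → ℝ) (Q : Measure T) (D : ℝ) (n : ℕ) (x : ℕ → S) : ℝ≥0∞ :=
  (n : ℝ≥0∞)⁻¹ *
    negLog ((Measure.pi fun _ : Fin n => Q) {y | rhoFin ρ n (fun k => x k) y ≤ D})

/-- The empirical distribution `P_{x_1^n} = (1/n) ∑_{k=1}^n δ_{x_k}`. -/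
def empMeas {S : Type*} [MeasurableSpace S] (n : ℕ) (x : ℕ → S) : Measure S :=
  (n : ℝ≥0∞)⁻¹ • ∑ k ∈ Finset.range n, Measure.dirac (x k)

/-- The `n`-dimensional marginal of a measure on sequences. -/
def margN {α : Type*} [MeasurableSpace α] (μ : Measure (ℕ → α)) (n : ℕ) :
    Measure (Fin n → α) :=
  μ.map fun x (k : Fin n) => x (k : ℕ)

/-- The strong mixing condition `C⁻¹ 𝒬(A) 𝒬(B) ≤ 𝒬(A ∩ B) ≤ C 𝒬(A) 𝒬(B)` for all
`A ∈ σ(Y_1^n)`, `B ∈ σ(Y_{n+1}^∞)` and all `n`. -/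
def Mixing {T : Type*} [MeasurableSpace T] (𝒬 : Measure (ℕ → T)) (C : ℝ) : Prop :=
  ∀ (n : ℕ) (A B : Set (ℕ → T)),
    MeasurableSet[MeasurableSpace.comap (fun y (k : Fin n) => y (k : ℕ)) inferInstance] A →
    MeasurableSet[MeasurableSpace.comap (fun y (k : ℕ) => y (k + n)) inferInstance] B →
    (ENNReal.ofReal C)⁻¹ * (𝒬 A * 𝒬 B) ≤ 𝒬 (A ∩ B) ∧
      𝒬 (A ∩ B) ≤ ENNReal.ofReal C * (𝒬 A * 𝒬 B)

/-- `L_n(x_1^n, Q_n, D) = -(1/n) log Q_n(B_n(x_1^n,D))` where `Q_n` is the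
`n`-dimensional marginal of the codebook process law `𝒬`. -/
def LnMem {S T : Type*} [MeasurableSpace T]
    (ρ : S × T → ℝ) (𝒬 : Measure (ℕ → T)) (D : ℝ) (n : ℕ) (x : ℕ → S) : ℝ≥0∞ :=
  (n : ℝ≥0∞)⁻¹ * negLog (margN 𝒬 n {y | rhoFin ρ n (fun k => x k) y ≤ D})

/-- The set `W_n(P_n,D)` of couplings on `S^n × T^n`. -/
def distSetN {S T : Type*} [MeasurableSpace S] [MeasurableSpace T]
    (ρ : S × T → ℝ) (n : ℕ) (Pn : Measure (Fin n → S)) (D : ℝ) :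
    Set (Measure ((Fin n → S) × (Fin n → T))) :=
  {W | IsProbabilityMeasure W ∧ W.map Prod.fst = Pn ∧
    ((∫⁻ z, ENNReal.ofReal (rhoFin ρ n z.1 z.2) ∂W : ℝ≥0∞) : EReal) ≤ ((D : ℝ) : EReal)}

/-- `R_n(P_n,Q_n,D) = (1/n) inf_{W_n ∈ W_n(P_n,D)} H(W_n‖P_n×Q_n)`. -/
def RnMem {S T : Type*} [MeasurableSpace S] [MeasurableSpace T]
    (ρ : S × T → ℝ) (n : ℕ) (Pn : Measure (Fin n → S)) (Qn : Measure (Fin n → T))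
    (D : ℝ) : ℝ≥0∞ :=
  (n : ℝ≥0∞)⁻¹ * ⨅ W ∈ distSetN ρ n Pn D, relEnt W (Pn.prod Qn)

/-- `Λ_n(P_n,Q_n,λ) = E_{X_1^n}[log E_{Y_1^n} e^{λ ρ_n(X_1^n,Y_1^n)}]`. -/
def LamN {S T : Type*} [MeasurableSpace S] [MeasurableSpace T]
    (ρ : S × T → ℝ) (n : ℕ) (Pn : Measure (Fin n → S)) (Qn : Measure (Fin n → T))
    (l : ℝ) : EReal :=
  Lam (fun z => rhoFin ρ n z.1 z.2) Pn Qn l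

/-- `Λ_n*(P_n,Q_n,D) = (1/n) sup_{λ ≤ 0} [λD - Λ_n(P_n,Q_n,λ)]`. -/
def LamStarN {S T : Type*} [MeasurableSpace S] [MeasurableSpace T]
    (ρ : S × T → ℝ) (n : ℕ) (Pn : Measure (Fin n → S)) (Qn : Measure (Fin n → T))
    (D : ℝ) : EReal :=
  (((n : ℝ)⁻¹ : ℝ) : EReal) *
    ⨆ l ∈ Iic (0 : ℝ), (((l * D : ℝ) : EReal) - LamN ρ n Pn Qn l)

/-- One-sided Fenchel–Legendre transform `D ↦ sup_{λ ≤ 0} [λD - Λ(λ)]` of a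
function `Λ : ℝ → EReal`. -/
def FLT (L : ℝ → EReal) (D : ℝ) : EReal :=
  ⨆ l ∈ Iic (0 : ℝ), (((l * D : ℝ) : EReal) - L l)


/-! ### Ergodic theory -/

section ErgodicPart

set_option linter.unusedSectionVars false

variable {Ω : Type*} [MeasurableSpace Ω]

/-- running maxima of Birkhoff sums -/
def runMax (T : Ω → Ω) (f : Ω → ℝ) : ℕ → Ω → ℝ
  | 0 => fun _ => 0
  | n + 1 => fun x => max 0 (f x + runMax T f n (T x))

theorem runMax_nonneg (T : Ω → Ω) (f : Ω → ℝ) (n : ℕ) (x : Ω) : 0 ≤ runMax T f n x := by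
  cases n with
  | zero => simp [runMax]
  | succ n => simp [runMax]

theorem runMax_le_succ (T : Ω → Ω) (f : Ω → ℝ) (n : ℕ) :
    ∀ x, runMax T f n x ≤ runMax T f (n + 1) x := by
  induction n with
  | zero => intro x; simp [runMax]
  | succ n ih =>
    intro x
    have := ih (T x)
    show max 0 (f x + runMax T f n (T x)) ≤ max 0 (f x + runMax T f (n + 1) (T x))
    gcongr

theorem runMax_mono (T : Ω → Ω) (f : Ω → ℝ) (x : Ω) : Monotone fun n => runMax T f n x :=
  monotone_nat_of_le_succ fun n => runMax_le_succ T f n x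

theorem birkhoff_le_runMax (T : Ω → Ω) (f : Ω → ℝ) (n : ℕ) :
    ∀ x, birkhoffSum T f n x ≤ runMax T f n x := by
  induction n with
  | zero => intro x; simp [runMax]
  | succ n ih =>
    intro x
    rw [birkhoffSum_succ']
    have := ih (T x)
    show _ ≤ max 0 (f x + runMax T f n (T x))
    exact le_max_of_le_right (by linarith)

theorem runMax_measurable {T : Ω → Ω} {f : Ω → ℝ} (hT : Measurable T) (hf : Measurable f) (n : ℕ) :
    Measurable (runMax T f n) := by
  induction n with
  | zero => exact measurable_const
  | succ n ih => exact measurable_const.max (hf.add (ih.comp hT))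

theorem runMax_integrable {T : Ω → Ω} {f : Ω → ℝ} {μ : Measure Ω} [IsProbabilityMeasure μ]
    (hT : MeasurePreserving T μ μ) (hf : Integrable f μ) (n : ℕ) :
    Integrable (runMax T f n) μ := by
  induction n with
  | zero => exact integrable_const 0
  | succ n ih =>
    exact (integrable_const (0:ℝ)).sup (hf.add (hT.integrable_comp_of_integrable ih))

theorem erg_bdd {T : Ω → Ω} {f : Ω → ℝ} {μ : Measure Ω} [IsProbabilityMeasure μ]
    (hT : Ergodic T μ) (hfm : Measurable f) (hf : Integrable f μ) (hneg : ∫ x, f x ∂μ < 0) :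
    ∀ᵐ x ∂μ, ∃ C : ℝ, ∀ n, birkhoffSum T f n x ≤ C := by
  set E : Set Ω := {x | ∀ C : ℕ, ∃ n, (C : ℝ) < runMax T f n x} with hE
  have hEm : MeasurableSet E := by
    have : E = ⋂ C : ℕ, ⋃ n, {x | (C : ℝ) < runMax T f n x} := by ext; simp [hE]
    rw [this]
    exact MeasurableSet.iInter fun C => MeasurableSet.iUnion fun n =>
      measurableSet_lt measurable_const (runMax_measurable hT.measurable hfm n)
  have hEi : T ⁻¹' E = E := by
    ext x
    constructor
    · intro h C
      obtain ⟨k, hk⟩ := exists_nat_gt (C - f x)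
      obtain ⟨n, hn⟩ := h k
      refine ⟨n + 1, ?_⟩
      show _ < max 0 (f x + runMax T f n (T x))
      exact lt_max_of_lt_right (by linarith)
    · intro h C
      obtain ⟨k, hk⟩ := exists_nat_gt (C + f x)
      obtain ⟨n, hn⟩ := h k
      have hn' : (k : ℝ) < runMax T f (n + 1) x := hn.trans_le (runMax_le_succ T f n x)
      refine ⟨n, ?_⟩
      have hn2 : (k : ℝ) < max 0 (f x + runMax T f n (T x)) := hn'
      rcases lt_max_iff.1 hn2 with h0 | h0
      · exact absurd h0 (not_lt.2 (Nat.cast_nonneg k))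
      · linarith
  rcases hT.toPreErgodic.ae_mem_or_ae_notMem hEm hEi with h | h
  · exfalso
    have hlim : Tendsto (fun n => ∫ x, max (-runMax T f n (T x)) (f x) ∂μ) atTop
        (𝓝 (∫ x, f x ∂μ)) := by
      refine tendsto_integral_of_dominated_convergence (fun x => |f x|) ?_ hf.abs ?_ ?_
      · intro n
        exact (((runMax_measurable hT.measurable hfm n).comp hT.measurable).neg.max
          hfm).aestronglyMeasurable
      · intro n
        refine Eventually.of_forall fun x => ?_
        rw [Real.norm_eq_abs, abs_le]
        have := runMax_nonneg T f n (T x)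
        constructor
        · exact le_max_of_le_right (neg_abs_le _)
        · exact max_le (by linarith [abs_nonneg (f x)]) (le_abs_self _)
      · filter_upwards [h] with x hx
        have hx' : T x ∈ E := by rw [← hEi] at hx; exact hx
        obtain ⟨k, hk⟩ := exists_nat_gt (- f x)
        obtain ⟨n, hn⟩ := hx' k
        refine tendsto_const_nhds.congr' ?_
        filter_upwards [eventually_ge_atTop n] with m hm
        have := runMax_mono T f (T x) hm
        simp only at this
        rw [max_eq_right]
        linarith
    have hnn : ∀ n, 0 ≤ ∫ x, max (-runMax T f n (T x)) (f x) ∂μ := by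
      intro n
      have e : ∀ x, max (-runMax T f n (T x)) (f x)
          = runMax T f (n + 1) x - runMax T f n (T x) := by
        intro x
        show _ = max 0 (f x + runMax T f n (T x)) - _
        rw [← max_sub_sub_right]; simp
      simp_rw [e]
      have hi := runMax_integrable hT.toMeasurePreserving hf
      have hi2 : Integrable (fun x => runMax T f n (T x)) μ :=
        hT.toMeasurePreserving.integrable_comp_of_integrable (hi n)
      rw [integral_sub (hi _) hi2]
      have : ∫ x, runMax T f n (T x) ∂μ = ∫ x, runMax T f n x ∂μ := by
        conv_rhs => rw [← hT.toMeasurePreserving.map_eq]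
        rw [integral_map hT.measurable.aemeasurable]
        exact (runMax_measurable hT.measurable hfm n).aestronglyMeasurable
      rw [this, sub_nonneg]
      exact integral_mono (hi _) (hi _) (runMax_le_succ T f n)
    exact absurd (ge_of_tendsto' hlim hnn) (not_le.2 hneg)
  · filter_upwards [h] with x hx
    simp only [hE, mem_ofPred_eq, not_forall, not_exists, not_lt] at hx
    obtain ⟨C, hC⟩ := hx
    exact ⟨C, fun n => (birkhoff_le_runMax T f n x).trans (hC n)⟩

theorem birk_upper {T : Ω → Ω} {f : Ω → ℝ} {μ : Measure Ω} [IsProbabilityMeasure μ]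
    (hT : Ergodic T μ) (hfm : Measurable f) (hf : Integrable f μ) {c : ℝ}
    (hc : ∫ x, f x ∂μ < c) :
    ∀ᵐ x ∂μ, ∀ᶠ n : ℕ in atTop, (n : ℝ)⁻¹ * birkhoffSum T f n x < c := by
  set e := (c - ∫ x, f x ∂μ) / 2 with he
  have hg : ∫ x, (f x - (c - e)) ∂μ < 0 := by
    rw [integral_sub hf (integrable_const _)]
    simp
    linarith
  filter_upwards [erg_bdd (f := fun x => f x - (c - e)) hT (hfm.sub_const _)
    (hf.sub (integrable_const _)) hg] with x ⟨C, hC⟩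
  obtain ⟨N, hN⟩ := exists_nat_gt (C / e)
  have epos : 0 < e := by rw [he]; linarith
  filter_upwards [eventually_ge_atTop N, eventually_gt_atTop 0] with n hn hn0
  have h1 := hC n
  have h2 : birkhoffSum T (fun x => f x - (c - e)) n x = birkhoffSum T f n x - n * (c - e) := by
    simp [birkhoffSum, Finset.sum_sub_distrib]
    ring
  rw [h2] at h1
  have h3 : C < n * e := by
    have : (N : ℝ) ≤ n := by exact_mod_cast hn
    rw [div_lt_iff₀ epos] at hN
    nlinarith
  have hnp : (0 : ℝ) < n := by exact_mod_cast hn0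
  rw [inv_mul_lt_iff₀ hnp]
  nlinarith

theorem birk_limit {T : Ω → Ω} {f : Ω → ℝ} {μ : Measure Ω} [IsProbabilityMeasure μ]
    (hT : Ergodic T μ) (hfm : Measurable f) (hf : Integrable f μ) :
    ∀ᵐ x ∂μ, Tendsto (fun n : ℕ => (n : ℝ)⁻¹ * birkhoffSum T f n x) atTop
      (𝓝 (∫ x, f x ∂μ)) := by
  have h1 : ∀ᵐ x ∂μ, ∀ m : ℕ, ∀ᶠ n : ℕ in atTop,
      (n : ℝ)⁻¹ * birkhoffSum T f n x < ∫ x, f x ∂μ + 1 / (m + 1) := by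
    rw [ae_all_iff]
    intro m
    refine birk_upper hT hfm hf ?_
    have : (0 : ℝ) < 1 / (m + 1) := by positivity
    linarith
  have h2 : ∀ᵐ x ∂μ, ∀ m : ℕ, ∀ᶠ n : ℕ in atTop,
      (n : ℝ)⁻¹ * birkhoffSum T (fun x => - f x) n x < ∫ x, - f x ∂μ + 1 / (m + 1) := by
    rw [ae_all_iff]
    intro m
    refine birk_upper (f := fun x => - f x) hT hfm.neg hf.neg ?_
    have : (0 : ℝ) < 1 / (m + 1) := by positivity
    linarith
  filter_upwards [h1, h2] with x hx1 hx2
  rw [Metric.tendsto_nhds]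
  intro ε hε
  obtain ⟨m, hm⟩ := exists_nat_one_div_lt hε
  filter_upwards [hx1 m, hx2 m] with n h1 h2
  have : birkhoffSum T (fun x => - f x) n x = - birkhoffSum T f n x := by
    simp [birkhoffSum]
  rw [this, integral_neg] at h2
  rw [Real.dist_eq, abs_lt]
  constructor <;> linarith

theorem birk_liminf {T : Ω → Ω} {f : Ω → ℝ} {μ : Measure Ω} [IsProbabilityMeasure μ]
    (hT : Ergodic T μ) (hfm : Measurable f) (hf : ∀ x, 0 ≤ f x) :
    ∀ᵐ x ∂μ, ∫⁻ x, ENNReal.ofReal (f x) ∂μ ≤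
      liminf (fun n : ℕ => ENNReal.ofReal ((n : ℝ)⁻¹ * birkhoffSum T f n x)) atTop := by
  have hint : ∀ N : ℕ, Integrable (fun x => min (f x) N) μ := by
    intro N
    refine Integrable.of_bound (hfm.min measurable_const).aestronglyMeasurable N ?_
    refine Eventually.of_forall fun x => ?_
    rw [Real.norm_eq_abs, abs_of_nonneg (le_min (hf x) (Nat.cast_nonneg N))]
    exact min_le_right _ _
  have h1 : ∀ᵐ x ∂μ, ∀ N : ℕ, Tendsto (fun n : ℕ => (n : ℝ)⁻¹ *
      birkhoffSum T (fun x => min (f x) N) n x) atTop (𝓝 (∫ x, min (f x) N ∂μ)) := by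
    rw [ae_all_iff]
    intro N
    exact birk_limit hT (hfm.min measurable_const) (hint N)
  have h2 : ∫⁻ x, ENNReal.ofReal (f x) ∂μ = ⨆ N : ℕ, ∫⁻ x, ENNReal.ofReal (min (f x) N) ∂μ := by
    rw [← lintegral_iSup]
    · congr 1
      ext x
      apply le_antisymm
      · obtain ⟨N, hN⟩ := exists_nat_ge (f x)
        refine le_iSup_of_le N ?_
        rw [min_eq_left hN]
      · exact iSup_le fun N => ENNReal.ofReal_le_ofReal (min_le_left _ _)
    · intro N
      exact (hfm.min measurable_const).ennreal_ofReal
    · intro N M h x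
      refine ENNReal.ofReal_le_ofReal ?_
      have : (N : ℝ) ≤ M := by exact_mod_cast h
      exact min_le_min le_rfl this
  filter_upwards [h1] with x hx
  rw [h2]
  refine iSup_le fun N => ?_
  rw [← ofReal_integral_eq_lintegral_ofReal (hint N)
    (Eventually.of_forall fun x => le_min (hf x) (Nat.cast_nonneg N))]
  have := (ENNReal.continuous_ofReal.tendsto _).comp (hx N)
  rw [← this.liminf_eq]
  refine liminf_le_liminf (Eventually.of_forall fun n => ?_)
  refine ENNReal.ofReal_le_ofReal ?_
  refine mul_le_mul_of_nonneg_left ?_ (by positivity)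
  exact Finset.sum_le_sum fun k _ => min_le_left _ _

theorem visit_bound {T : Ω → Ω} {f : Ω → ℝ} {A B : Set Ω} {N : ℕ} {ε : ℝ}
    (hA : ∀ x ∈ A, ∀ m, 1 ≤ m → 0 < birkhoffSum T f m x)
    (hB : ∀ x ∈ B, x ∈ A ∧ (∃ m, 1 ≤ m ∧ m ≤ N ∧ T^[m] x ∈ A) ∧
      ∀ m, 1 ≤ m → m ≤ N → ε ≤ birkhoffSum T f m x) (n : ℕ) :
    ∀ x ∈ A, T^[n] x ∈ A → ε * birkhoffSum T (B.indicator fun _ => (1:ℝ)) n x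
      ≤ birkhoffSum T f n x := by
  induction n using Nat.strong_induction_on with
  | _ n ih =>
    intro x hx hn
    rcases Nat.eq_zero_or_pos n with rfl | hpos
    · simp
    have hex : ∃ m, 1 ≤ m ∧ T^[m] x ∈ A := ⟨n, hpos, hn⟩
    set t := Nat.find hex with ht
    obtain ⟨ht1, htA⟩ := Nat.find_spec hex
    have htn : t ≤ n := Nat.find_min' hex ⟨hpos, hn⟩
    obtain ⟨r, hr⟩ := Nat.exists_eq_add_of_le htn
    have h1 := ih r (by omega) (T^[t] x) htA
      (by rw [← Function.iterate_add_apply, add_comm, ← hr]; exact hn)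
    rw [hr, birkhoffSum_add, birkhoffSum_add]
    have h2 : ε * birkhoffSum T (B.indicator fun _ => (1:ℝ)) t x ≤ birkhoffSum T f t x := by
      have h3 : birkhoffSum T (B.indicator fun _ => (1:ℝ)) t x = B.indicator (fun _ => (1:ℝ)) x := by
        rw [birkhoffSum, Finset.sum_eq_single_of_mem 0]
        · simp
        · simp; omega
        · intro k hk hk0
          have hkt : k < t := Finset.mem_range.1 hk
          have := Nat.find_min hex hkt
          refine indicator_of_notMem (fun hb => this ⟨by omega, (hB _ hb).1⟩) _
      rw [h3]
      by_cases hxB : x ∈ B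
      · obtain ⟨-, ⟨m, hm1, hmN, hmA⟩, h⟩ := hB x hxB
        have : t ≤ m := Nat.find_min' hex ⟨hm1, hmA⟩
        simp [hxB]
        exact h t ht1 (this.trans hmN)
      · simp [hxB]
        exact (hA x hx t ht1).le
    rw [mul_add]
    linarith

theorem recurrent_null {T : Ω → Ω} {f : Ω → ℝ} {μ : Measure Ω} [IsProbabilityMeasure μ]
    (hT : Ergodic T μ) (hfm : Measurable f) (hf : Integrable f μ) (h0 : ∫ x, f x ∂μ = 0) :
    μ {x | ∀ m, 1 ≤ m → 0 < birkhoffSum T f m x} = 0 := by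
  set A := {x | ∀ m, 1 ≤ m → 0 < birkhoffSum T f m x} with hA
  have hSm : ∀ m, Measurable (birkhoffSum T f m) := by
    intro m
    show Measurable (fun x => ∑ k ∈ Finset.range m, f (T^[k] x))
    exact Finset.measurable_sum _ fun k _ => hfm.comp (hT.measurable.iterate k)
  have hAm : MeasurableSet A := by
    have : A = ⋂ m, ⋂ (_ : 1 ≤ m), {x | 0 < birkhoffSum T f m x} := by ext; simp [hA]
    rw [this]
    exact MeasurableSet.iInter fun m => MeasurableSet.iInter fun _ =>
      measurableSet_lt measurable_const (hSm m)
  by_contra hne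
  set B : ℕ → ℕ → Set Ω := fun N j => {x | x ∈ A ∧ (∃ m, 1 ≤ m ∧ m ≤ N ∧ T^[m] x ∈ A) ∧
      ∀ m, 1 ≤ m → m ≤ N → (1 / (j + 1) : ℝ) ≤ birkhoffSum T f m x} with hB
  have hBm : ∀ N j, MeasurableSet (B N j) := by
    intro N j
    have : B N j = A ∩ ((⋃ m, ⋃ (_ : 1 ≤ m), ⋃ (_ : m ≤ N), T^[m] ⁻¹' A) ∩
        (⋂ m, ⋂ (_ : 1 ≤ m), ⋂ (_ : m ≤ N), {x | (1 / (j + 1) : ℝ) ≤ birkhoffSum T f m x})) := by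
      ext x; simp [hB]; tauto
    rw [this]
    refine hAm.inter (MeasurableSet.inter ?_ ?_)
    · exact MeasurableSet.iUnion fun m => MeasurableSet.iUnion fun _ => MeasurableSet.iUnion fun _ =>
        hT.measurable.iterate m hAm
    · exact MeasurableSet.iInter fun m => MeasurableSet.iInter fun _ => MeasurableSet.iInter fun _ =>
        measurableSet_le measurable_const (hSm m)
  have hrec := hT.toMeasurePreserving.conservative.ae_mem_imp_frequently_image_mem
    hAm.nullMeasurableSet
  have hcover : ∀ᵐ x ∂μ, x ∈ A → ∃ N j, x ∈ B N j := by
    filter_upwards [hrec] with x hx hxA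
    obtain ⟨N, hN1, hNA⟩ := (frequently_atTop.1 (hx hxA)) 1
    have hne : (Finset.Icc 1 N).Nonempty := ⟨N, by simp; omega⟩
    obtain ⟨m0, hm0, hmin⟩ := Finset.exists_min_image (Finset.Icc 1 N)
      (fun m => birkhoffSum T f m x) hne
    have hpos := hxA m0 (Finset.mem_Icc.1 hm0).1
    obtain ⟨j, hj⟩ := exists_nat_one_div_lt hpos
    refine ⟨N, j, hxA, ⟨N, hN1, le_rfl, hNA⟩, fun m h1 h2 => ?_⟩
    exact hj.le.trans (hmin m (Finset.mem_Icc.2 ⟨h1, h2⟩))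
  have hex : ∃ N j, μ (B N j) ≠ 0 := by
    by_contra hcon
    push Not at hcon
    have h1 : ∀ᵐ x ∂μ, ∀ N j, x ∉ B N j := by
      rw [ae_all_iff]; intro N; rw [ae_all_iff]; intro j
      exact measure_eq_zero_iff_ae_notMem.1 (hcon N j)
    apply hne
    rw [measure_eq_zero_iff_ae_notMem]
    filter_upwards [h1, hcover] with x h1 h2 hxA
    obtain ⟨N, j, h⟩ := h2 hxA
    exact h1 N j h
  obtain ⟨N, j, hNj⟩ := hex
  have hl1 := birk_limit hT hfm hf
  have hl2 := birk_limit hT (f := (B N j).indicator fun _ => (1:ℝ))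
    (measurable_const.indicator (hBm N j)) ((integrable_const _).indicator (hBm N j))
  have : ∀ᵐ x ∂μ, x ∉ A := by
    filter_upwards [hrec, hl1, hl2] with x hr h1 h2 hxA
    rw [integral_indicator_const _ (hBm N j)] at h2
    simp only [smul_eq_mul, mul_one] at h2
    rw [h0] at h1
    have hpos : 0 < μ.real (B N j) := by
      rw [measureReal_def, ENNReal.toReal_pos_iff]
      exact ⟨pos_iff_ne_zero.2 hNj, measure_lt_top _ _⟩
    have hj : (0:ℝ) < 1 / (j + 1) := by positivity
    have h3 := (h2.const_mul (1 / (j + 1) : ℝ)).sub h1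
    have h4 : (0:ℝ) < 1 / (j + 1) * μ.real (B N j) - 0 := by rw [sub_zero]; positivity
    have h5 := h3.eventually (lt_mem_nhds h4)
    obtain ⟨n, hnA, hn5⟩ := ((hr hxA).and_eventually h5).exists
    have h6 := visit_bound (A := A) (B := B N j) (f := f) (T := T) (N := N)
      (ε := 1 / (j + 1)) (fun x hx => hx)
      (fun x hx => hx) n x hxA hnA
    have h7 : (0:ℝ) ≤ (n:ℝ)⁻¹ := by positivity
    nlinarith [mul_le_mul_of_nonneg_left h6 h7]
  exact hne (measure_eq_zero_iff_ae_notMem.2 this)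

theorem recurrent_freq {T : Ω → Ω} {f : Ω → ℝ} {μ : Measure Ω} [IsProbabilityMeasure μ]
    (hT : Ergodic T μ) (hfm : Measurable f) (hf : Integrable f μ) (h0 : ∫ x, f x ∂μ ≤ 0) :
    ∀ᵐ x ∂μ, ∃ᶠ n in atTop, birkhoffSum T f n x ≤ 0 := by
  set c := ∫ x, f x ∂μ with hc
  have h1 : ∫ x, (f x - c) ∂μ = 0 := by
    rw [integral_sub hf (integrable_const _)]; simp [hc]
  have h2 := recurrent_null hT (f := fun x => f x - c) (hfm.sub_const _)
    (hf.sub (integrable_const _)) h1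
  rw [measure_eq_zero_iff_ae_notMem] at h2
  have h3 : ∀ᵐ x ∂μ, ∀ n, T^[n] x ∉ {x | ∀ m, 1 ≤ m → 0 < birkhoffSum T (fun x => f x - c) m x} := by
    rw [ae_all_iff]
    intro n
    exact (hT.toMeasurePreserving.iterate n).quasiMeasurePreserving.ae h2
  filter_upwards [h3] with x hx
  have h4 : ∀ N, ∃ n, N ≤ n ∧ birkhoffSum T (fun x => f x - c) n x ≤ 0 := by
    intro N
    induction N with
    | zero => exact ⟨0, le_rfl, by simp⟩
    | succ N ih =>
      obtain ⟨n, hn, hS⟩ := ih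
      have := hx n
      simp only [mem_ofPred_eq, not_forall, not_lt] at this
      obtain ⟨m, hm, hm2⟩ := this
      refine ⟨n + m, by omega, ?_⟩
      rw [birkhoffSum_add]
      linarith
  rw [frequently_atTop]
  intro N
  obtain ⟨n, hn, h⟩ := h4 N
  refine ⟨n, hn, le_trans ?_ h⟩
  refine Finset.sum_le_sum fun k _ => ?_
  simp only
  linarith

end ErgodicPart


/-! ### Single-letter analysis -/

section SingleLetter

set_option linter.unusedSectionVars false

theorem lintegral_eq_iSup_min {α : Type*} [MeasurableSpace α] {μ : Measure α} {f : α → ℝ}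
    (hfm : Measurable f) :
    ∫⁻ x, ENNReal.ofReal (f x) ∂μ = ⨆ N : ℕ, ∫⁻ x, ENNReal.ofReal (min (f x) N) ∂μ := by
  rw [← lintegral_iSup]
  · congr 1
    ext x
    apply le_antisymm
    · obtain ⟨N, hN⟩ := exists_nat_ge (f x)
      refine le_iSup_of_le N ?_
      rw [min_eq_left hN]
    · exact iSup_le fun N => ENNReal.ofReal_le_ofReal (min_le_left _ _)
  · intro N
    exact (hfm.min measurable_const).ennreal_ofReal
  · intro N M h x
    refine ENNReal.ofReal_le_ofReal ?_
    have : (N : ℝ) ≤ M := by exact_mod_cast h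
    exact min_le_min le_rfl this

theorem gibbs_le {α : Type*} [MeasurableSpace α] {μ ν : Measure α} [IsProbabilityMeasure μ]
    [IsProbabilityMeasure ν] {φ : α → ℝ} (hφm : Measurable φ) (hφ : Integrable φ μ)
    (h : ∫⁻ x, ENNReal.ofReal (Real.exp (φ x)) ∂ν ≤ 1) :
    ENNReal.ofReal (∫ x, φ x ∂μ) ≤ relEnt μ ν := by
  unfold relEnt
  split_ifs with hc
  · obtain ⟨hac, hint⟩ := hc
    refine ENNReal.ofReal_le_ofReal ?_
    have h1 : ∫⁻ x, ENNReal.ofReal (Real.exp (φ x - llr μ ν x)) ∂μ ≤ 1 := by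
      calc ∫⁻ x, ENNReal.ofReal (Real.exp (φ x - llr μ ν x)) ∂μ
          = ∫⁻ x, ENNReal.ofReal (Real.exp (φ x)) * ν.rnDeriv μ x ∂μ := by
            refine lintegral_congr_ae ?_
            filter_upwards [exp_neg_llr hac, Measure.rnDeriv_lt_top ν μ] with x hx hx2
            have hx' : Real.exp (-llr μ ν x) = (ν.rnDeriv μ x).toReal := hx
            rw [sub_eq_add_neg, Real.exp_add, hx', ENNReal.ofReal_mul (Real.exp_nonneg _),
              ENNReal.ofReal_toReal hx2.ne]
        _ = ∫⁻ x, ENNReal.ofReal (Real.exp (φ x)) ∂(μ.withDensity (ν.rnDeriv μ)) := by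
            rw [lintegral_withDensity_eq_lintegral_mul _ (Measure.measurable_rnDeriv _ _)
              hφm.exp.ennreal_ofReal]
            refine lintegral_congr fun x => ?_
            simp [mul_comm]
        _ ≤ ∫⁻ x, ENNReal.ofReal (Real.exp (φ x)) ∂ν :=
            lintegral_mono' (Measure.withDensity_rnDeriv_le _ _) le_rfl
        _ ≤ 1 := h
    have hm : Measurable fun x => Real.exp (φ x - llr μ ν x) :=
      (hφm.sub (measurable_llr μ ν)).exp
    have h2 : Integrable (fun x => Real.exp (φ x - llr μ ν x)) μ := by
      refine ⟨hm.aestronglyMeasurable, ?_⟩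
      rw [hasFiniteIntegral_iff_ofReal (Eventually.of_forall fun x => Real.exp_nonneg _)]
      exact h1.trans_lt ENNReal.one_lt_top
    have h3 : ∫ x, Real.exp (φ x - llr μ ν x) ∂μ ≤ 1 := by
      rw [integral_eq_lintegral_of_nonneg_ae (Eventually.of_forall fun x => Real.exp_nonneg _)
        hm.aestronglyMeasurable]
      exact ENNReal.toReal_le_of_le_ofReal zero_le_one (by simpa using h1)
    have h4 : ∫ x, (φ x - llr μ ν x) ∂μ ≤ ∫ x, (Real.exp (φ x - llr μ ν x) - 1) ∂μ := by
      refine integral_mono (hφ.sub hint) (h2.sub (integrable_const _)) fun x => ?_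
      have := Real.add_one_le_exp (φ x - llr μ ν x)
      simp only
      linarith
    rw [integral_sub hφ hint, integral_sub h2 (integrable_const _)] at h4
    simp at h4
    linarith
  · exact le_top

variable {S T : Type*} [MeasurableSpace S] [MeasurableSpace T]

/-- partition function -/
def Zf (ρ : S × T → ℝ) (Q : Measure T) (l : ℝ) (x : S) : ℝ :=
  ∫ y, Real.exp (-(l * ρ (x, y))) ∂Q

/-- log-partition function with a minus sign -/
def fl (ρ : S × T → ℝ) (Q : Measure T) (l : ℝ) (x : S) : ℝ := -Real.log (Zf ρ Q l x)

/-- tilted density -/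
def wl (ρ : S × T → ℝ) (Q : Measure T) (l : ℝ) (z : S × T) : ℝ :=
  Real.exp (-(l * ρ z)) / Zf ρ Q l z.1

/-- tilted mean -/
def ml (ρ : S × T → ℝ) (Q : Measure T) (l : ℝ) (x : S) : ℝ :=
  (∫ y, ρ (x, y) * Real.exp (-(l * ρ (x, y))) ∂Q) / Zf ρ Q l x

variable {ρ : S × T → ℝ} {P : Measure S} {Q : Measure T}
  [IsProbabilityMeasure P] [IsProbabilityMeasure Q]

theorem exp_int (hρm : Measurable ρ) (hρ0 : ∀ z, 0 ≤ ρ z) {l : ℝ} (hl : 0 ≤ l) (x : S) :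
    Integrable (fun y => Real.exp (-(l * ρ (x, y)))) Q := by
  refine Integrable.of_bound (Measurable.aestronglyMeasurable (by fun_prop)) 1
    (Eventually.of_forall fun y => ?_)
  rw [Real.norm_eq_abs, abs_of_pos (Real.exp_pos _), Real.exp_le_one_iff]
  have := mul_nonneg hl (hρ0 (x, y))
  linarith

theorem Zf_pos (hρm : Measurable ρ) (hρ0 : ∀ z, 0 ≤ ρ z) {l : ℝ} (hl : 0 ≤ l) (x : S) :
    0 < Zf ρ Q l x := integral_exp_pos (exp_int hρm hρ0 hl x)

theorem Zf_anti (hρm : Measurable ρ) (hρ0 : ∀ z, 0 ≤ ρ z) {l k : ℝ} (hl : 0 ≤ l) (hk : l ≤ k)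
    (x : S) : Zf ρ Q k x ≤ Zf ρ Q l x := by
  refine integral_mono (exp_int hρm hρ0 (hl.trans hk) x) (exp_int hρm hρ0 hl x) fun y => ?_
  simp only
  gcongr
  exact hρ0 _

theorem Zf_zero (x : S) : Zf ρ Q 0 x = 1 := by simp [Zf]

theorem fl_mono (hρm : Measurable ρ) (hρ0 : ∀ z, 0 ≤ ρ z) {l k : ℝ} (hl : 0 ≤ l) (hk : l ≤ k)
    (x : S) : fl ρ Q l x ≤ fl ρ Q k x := by
  unfold fl
  exact neg_le_neg (Real.log_le_log (Zf_pos hρm hρ0 (hl.trans hk) x) (Zf_anti hρm hρ0 hl hk x))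

theorem fl_nonneg (hρm : Measurable ρ) (hρ0 : ∀ z, 0 ≤ ρ z) {l : ℝ} (hl : 0 ≤ l)
    (x : S) : 0 ≤ fl ρ Q l x := by
  have := fl_mono (Q := Q) hρm hρ0 le_rfl hl x
  simpa [fl, Zf_zero] using this

theorem exp_neg_fl (hρm : Measurable ρ) (hρ0 : ∀ z, 0 ≤ ρ z) {l : ℝ} (hl : 0 ≤ l)
    (x : S) : Real.exp (-fl ρ Q l x) = Zf ρ Q l x := by
  rw [fl, neg_neg, Real.exp_log (Zf_pos hρm hρ0 hl x)]

theorem Zf_meas (hρm : Measurable ρ) (l : ℝ) : Measurable (Zf ρ Q l) := by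
  have : StronglyMeasurable (fun z : S × T => Real.exp (-(l * ρ z))) :=
    Measurable.stronglyMeasurable (by fun_prop)
  exact (this.integral_prod_right' (ν := Q)).measurable

theorem fl_meas (hρm : Measurable ρ) (l : ℝ) : Measurable (fl ρ Q l) :=
  (Zf_meas hρm l).log.neg

theorem ml_meas (hρm : Measurable ρ) (l : ℝ) : Measurable (ml ρ Q l) := by
  have : StronglyMeasurable (fun z : S × T => ρ z * Real.exp (-(l * ρ z))) :=
    Measurable.stronglyMeasurable (by fun_prop)
  exact (this.integral_prod_right' (ν := Q)).measurable.div (Zf_meas hρm l)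

theorem wl_meas (hρm : Measurable ρ) (l : ℝ) : Measurable (wl ρ Q l) := by
  have : Measurable (fun z : S × T => Zf ρ Q l z.1) := (Zf_meas hρm l).comp measurable_fst
  exact (Measurable.exp (by fun_prop)).div this

theorem wl_eq (hρm : Measurable ρ) (hρ0 : ∀ z, 0 ≤ ρ z) {l : ℝ} (hl : 0 ≤ l) (z : S × T) :
    wl ρ Q l z = Real.exp (-(l * ρ z) + fl ρ Q l z.1) := by
  have h := exp_neg_fl (Q := Q) hρm hρ0 hl z.1
  rw [wl, ← h, Real.exp_add, Real.exp_neg (fl ρ Q l z.1), div_inv_eq_mul]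

theorem rho_exp_le (hρ0 : ∀ z, 0 ≤ ρ z) {l : ℝ} (hl : 0 < l) (z : S × T) :
    ρ z * Real.exp (-(l * ρ z)) ≤ 1 / l := by
  have h1 := Real.add_one_le_exp (l * ρ z)
  rw [Real.exp_neg, ← div_eq_mul_inv, div_le_div_iff₀ (Real.exp_pos _) hl]
  nlinarith

theorem rho_exp_int (hρm : Measurable ρ) (hρ0 : ∀ z, 0 ≤ ρ z) {l : ℝ} (hl : 0 < l) (x : S) :
    Integrable (fun y => ρ (x, y) * Real.exp (-(l * ρ (x, y)))) Q := by
  refine Integrable.of_bound (by fun_prop) (1 / l) (Eventually.of_forall fun y => ?_)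
  rw [Real.norm_eq_abs, abs_of_nonneg (mul_nonneg (hρ0 _) (Real.exp_nonneg _))]
  exact rho_exp_le hρ0 hl _

theorem ml_nonneg (hρm : Measurable ρ) (hρ0 : ∀ z, 0 ≤ ρ z) {l : ℝ} (hl : 0 ≤ l) (x : S) :
    0 ≤ ml ρ Q l x :=
  div_nonneg (integral_nonneg fun y => mul_nonneg (hρ0 _) (Real.exp_nonneg _))
    (Zf_pos hρm hρ0 hl x).le

theorem mul_ml_le (hρm : Measurable ρ) (hρ0 : ∀ z, 0 ≤ ρ z) {l : ℝ} (hl : 0 < l) (x : S) :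
    l * ml ρ Q l x ≤ fl ρ Q l x := by
  have hZ := Zf_pos (Q := Q) hρm hρ0 hl.le x
  set Z := Zf ρ Q l x with hZd
  set f := fl ρ Q l x with hf
  have key : ∀ y, Real.exp (-(l * ρ (x, y))) / Z - 1 ≤
      f * (Real.exp (-(l * ρ (x, y))) / Z) -
        l * (ρ (x, y) * Real.exp (-(l * ρ (x, y))) / Z) := by
    intro y
    have h1 := wl_eq (Q := Q) hρm hρ0 hl.le (x, y)
    rw [wl] at h1
    change Real.exp (-(l * ρ (x, y))) / Z = Real.exp (-(l * ρ (x, y)) + f) at h1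
    have h2 : ρ (x, y) * Real.exp (-(l * ρ (x, y))) / Z
      = ρ (x, y) * Real.exp (-(l * ρ (x, y)) + f) := by rw [← h1]; ring
    rw [h2, h1]
    set u := -(l * ρ (x, y)) + f with hu
    have h3 := Real.add_one_le_exp (-u)
    have h4 : Real.exp (-u) * Real.exp u = 1 := by rw [← Real.exp_add]; simp
    have h5 := Real.exp_pos u
    have h6 : Real.exp u - 1 ≤ u * Real.exp u := by nlinarith
    rw [hu] at h6 ⊢
    linarith
  have i1 := (exp_int (Q := Q) hρm hρ0 hl.le x).div_const Z
  have i2 := (rho_exp_int (Q := Q) hρm hρ0 hl x).div_const Z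
  have h := integral_mono (i1.sub (integrable_const 1)) ((i1.const_mul f).sub (i2.const_mul l)) key
  simp only [Pi.sub_apply] at h
  rw [integral_sub i1 (integrable_const 1), integral_sub (i1.const_mul f) (i2.const_mul l),
    integral_const_mul, integral_const_mul, integral_div, integral_div] at h
  have e1 : (∫ y, Real.exp (-(l * ρ (x, y))) ∂Q) / Z = 1 := div_self hZ.ne'
  rw [e1] at h
  simp at h
  exact h

theorem ml_int (hρm : Measurable ρ) (hρ0 : ∀ z, 0 ≤ ρ z) {l : ℝ} (hl : 0 < l)
    (hF : Integrable (fl ρ Q l) P) : Integrable (ml ρ Q l) P := by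
  refine (hF.const_mul (l⁻¹)).mono' (ml_meas hρm l).aestronglyMeasurable
    (Eventually.of_forall fun x => ?_)
  rw [Real.norm_eq_abs, abs_of_nonneg (ml_nonneg hρm hρ0 hl.le x)]
  rw [le_inv_mul_iff₀ hl]
  exact mul_ml_le hρm hρ0 hl x

theorem dl_cont (hρm : Measurable ρ) (hρ0 : ∀ z, 0 ≤ ρ z) {a b : ℝ} (ha : 0 < a)
    (hF : Integrable (fl ρ Q b) P) :
    ContinuousOn (fun l => ∫ x, ml ρ Q l x ∂P) (Icc a b) := by
  refine continuousOn_of_dominated (bound := fun x => a⁻¹ * fl ρ Q b x)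
    (fun l _ => (ml_meas hρm l).aestronglyMeasurable) ?_ (hF.const_mul _) ?_
  · intro l hl
    refine Eventually.of_forall fun x => ?_
    have hl0 : 0 < l := ha.trans_le hl.1
    rw [Real.norm_eq_abs, abs_of_nonneg (ml_nonneg hρm hρ0 hl0.le x), le_inv_mul_iff₀ ha]
    have h1 := mul_ml_le (Q := Q) hρm hρ0 hl0 x
    have h2 := fl_mono (Q := Q) hρm hρ0 hl0.le hl.2 x
    have h3 := ml_nonneg (Q := Q) hρm hρ0 hl0.le x
    nlinarith [hl.1]
  · refine Eventually.of_forall fun x => ?_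
    refine ContinuousOn.div ?_ ?_ ?_
    · refine continuousOn_of_dominated (bound := fun _ => 1 / a) (fun l _ => by fun_prop) ?_
        (integrable_const _) ?_
      · intro l hl
        refine Eventually.of_forall fun y => ?_
        rw [Real.norm_eq_abs, abs_of_nonneg (mul_nonneg (hρ0 _) (Real.exp_nonneg _))]
        exact (rho_exp_le hρ0 (ha.trans_le hl.1) _).trans
          (one_div_le_one_div_of_le ha hl.1)
      · exact Eventually.of_forall fun y => by fun_prop
    · refine continuousOn_of_dominated (bound := fun _ => 1)
        (fun l _ => Measurable.aestronglyMeasurable (by fun_prop)) ?_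
        (integrable_const _) ?_
      · intro l hl
        refine Eventually.of_forall fun y => ?_
        rw [Real.norm_eq_abs, abs_of_pos (Real.exp_pos _), Real.exp_le_one_iff]
        have := mul_nonneg (ha.le.trans hl.1) (hρ0 (x, y))
        linarith
      · exact Eventually.of_forall fun y => by fun_prop
    · intro l hl
      exact (Zf_pos hρm hρ0 (ha.le.trans hl.1) x).ne'

theorem Rrate_ge (hρm : Measurable ρ) (hρ0 : ∀ z, 0 ≤ ρ z) {l : ℝ} (hl : 0 ≤ l) (D : ℝ) :
    ∫⁻ x, ENNReal.ofReal (fl ρ Q l x) ∂P ≤ Rrate ρ P Q D + ENNReal.ofReal (l * D) := by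
  rw [← tsub_le_iff_right]
  unfold Rrate
  refine le_iInf₂ fun W hW => ?_
  rw [tsub_le_iff_right]
  obtain ⟨hWp, hWm, hWD⟩ := hW
  have hD0 : 0 ≤ D := by
    have h0 : ((0 : ℝ) : EReal) ≤ (D : EReal) := by
      refine le_trans ?_ hWD
      exact EReal.coe_ennreal_nonneg _
    exact_mod_cast h0
  have hWD' : ∫⁻ z, ENNReal.ofReal (ρ z) ∂W ≤ ENNReal.ofReal D := by
    rw [← EReal.coe_ennreal_le_coe_ennreal_iff, EReal.coe_ennreal_ofReal, max_eq_left hD0]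
    exact hWD
  have hρi : Integrable ρ W := by
    refine ⟨hρm.aestronglyMeasurable, ?_⟩
    rw [hasFiniteIntegral_iff_ofReal (Eventually.of_forall hρ0)]
    exact hWD'.trans_lt ENNReal.ofReal_lt_top
  have hρD : ∫ z, ρ z ∂W ≤ D := by
    rw [integral_eq_lintegral_of_nonneg_ae (Eventually.of_forall hρ0) hρm.aestronglyMeasurable]
    exact ENNReal.toReal_le_of_le_ofReal hD0 hWD'
  rw [lintegral_eq_iSup_min (fl_meas hρm l)]
  refine iSup_le fun N => ?_
  have hgm : Measurable fun x => min (fl ρ Q l x) N := (fl_meas hρm l).min measurable_const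
  have hg0 : ∀ x, 0 ≤ min (fl ρ Q l x) N :=
    fun x => le_min (fl_nonneg hρm hρ0 hl x) (Nat.cast_nonneg N)
  have i1 : Integrable (fun x => min (fl ρ Q l x) (N:ℝ)) P := by
    refine Integrable.of_bound hgm.aestronglyMeasurable N (Eventually.of_forall fun x => ?_)
    rw [Real.norm_eq_abs, abs_of_nonneg (hg0 _)]
    exact min_le_right _ _
  have i2 : Integrable (fun z : S × T => min (fl ρ Q l z.1) (N:ℝ)) W := by
    refine Integrable.of_bound (hgm.comp measurable_fst).aestronglyMeasurable N
      (Eventually.of_forall fun x => ?_)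
    rw [Real.norm_eq_abs, abs_of_nonneg (hg0 _)]
    exact min_le_right _ _
  rw [← ofReal_integral_eq_lintegral_ofReal i1 (Eventually.of_forall hg0)]
  have e1 : ∫ x, min (fl ρ Q l x) N ∂P = ∫ z, min (fl ρ Q l z.1) N ∂W := by
    rw [← hWm, integral_map measurable_fst.aemeasurable hgm.aestronglyMeasurable]
  have hg := gibbs_le (μ := W) (ν := P.prod Q)
    (φ := fun z => -(l * ρ z) + min (fl ρ Q l z.1) N)
    ((hρm.const_mul l).neg.add (hgm.comp measurable_fst)) ((hρi.const_mul l).neg.add i2) ?_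
  · have i3 : Integrable (fun z => -(l * ρ z)) W := (hρi.const_mul l).neg
    rw [integral_add i3 i2, integral_neg, integral_const_mul, ← e1] at hg
    have h3 : ENNReal.ofReal (∫ x, min (fl ρ Q l x) N ∂P) ≤
        ENNReal.ofReal (-(l * ∫ z, ρ z ∂W) + ∫ x, min (fl ρ Q l x) N ∂P)
          + ENNReal.ofReal (l * D) := by
      refine le_trans (ENNReal.ofReal_le_ofReal ?_) ENNReal.ofReal_add_le
      have := mul_le_mul_of_nonneg_left hρD hl
      linarith
    exact h3.trans (add_le_add_left hg _)
  · have hm : Measurable fun z : S × T =>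
        ENNReal.ofReal (Real.exp (-(l * ρ z) + min (fl ρ Q l z.1) N)) :=
      ((hρm.const_mul l).neg.add (hgm.comp measurable_fst)).exp.ennreal_ofReal
    rw [lintegral_prod _ hm.aemeasurable]
    have : ∀ x, ∫⁻ y, ENNReal.ofReal (Real.exp (-(l * ρ (x, y)) + min (fl ρ Q l x) N)) ∂Q ≤ 1 := by
      intro x
      calc ∫⁻ y, ENNReal.ofReal (Real.exp (-(l * ρ (x, y)) + min (fl ρ Q l x) N)) ∂Q
          ≤ ∫⁻ y, ENNReal.ofReal (wl ρ Q l (x, y)) ∂Q := by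
            refine lintegral_mono fun y => ENNReal.ofReal_le_ofReal ?_
            rw [wl_eq hρm hρ0 hl]
            gcongr
            exact min_le_left _ _
        _ = 1 := by
            have hi := (exp_int (Q := Q) hρm hρ0 hl x).div_const (Zf ρ Q l x)
            unfold wl
            rw [← ofReal_integral_eq_lintegral_ofReal hi
              (Eventually.of_forall fun y => div_nonneg (Real.exp_nonneg _)
                (Zf_pos hρm hρ0 hl x).le), integral_div]
            rw [← ENNReal.ofReal_one]
            congr 1
            exact div_self (Zf_pos (Q := Q) hρm hρ0 hl x).ne'
    calc _ ≤ ∫⁻ x, 1 ∂P := lintegral_mono this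
      _ = 1 := by simp

end SingleLetter


/-! ### The source process and the Chernoff bound -/

section Lower

set_option linter.unusedSectionVars false

theorem negLog_ge {t : ℝ≥0∞} {c : ℝ} (h : t ≤ ENNReal.ofReal (Real.exp (-c))) :
    ENNReal.ofReal c ≤ negLog t := by
  unfold negLog
  split_ifs with h0
  · exact le_top
  · refine ENNReal.ofReal_le_ofReal ?_
    have ht : t ≠ ∞ := (h.trans_lt ENNReal.ofReal_lt_top).ne
    have h1 : t.toReal ≤ Real.exp (-c) := ENNReal.toReal_le_of_le_ofReal (Real.exp_nonneg _) h
    have h2 := Real.log_le_log (ENNReal.toReal_pos h0 ht) h1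
    rw [Real.log_exp] at h2
    linarith

theorem negLog_le {t : ℝ≥0∞} {c : ℝ} (h : ENNReal.ofReal (Real.exp (-c)) ≤ t) (ht : t ≤ 1) :
    negLog t ≤ ENNReal.ofReal c := by
  unfold negLog
  have h0 : t ≠ 0 := ((ENNReal.ofReal_pos.2 (Real.exp_pos _)).trans_le h).ne'
  have ht' : t ≠ ∞ := (ht.trans_lt ENNReal.one_lt_top).ne
  rw [if_neg h0]
  refine ENNReal.ofReal_le_ofReal ?_
  have h1 : Real.exp (-c) ≤ t.toReal := (ENNReal.ofReal_le_iff_le_toReal ht').1 h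
  have h2 := Real.log_le_log (Real.exp_pos _) h1
  rw [Real.log_exp] at h2
  linarith

theorem inv_mul_ofReal {n : ℕ} (hn : 0 < n) (c : ℝ) :
    (n : ℝ≥0∞)⁻¹ * ENNReal.ofReal c = ENNReal.ofReal ((n : ℝ)⁻¹ * c) := by
  rw [ENNReal.ofReal_mul (by positivity), ENNReal.ofReal_inv_of_pos (by exact_mod_cast hn),
    ENNReal.ofReal_natCast]

theorem lintegral_pi_prod {T : Type*} [MeasurableSpace T] {n : ℕ} (μ : Fin n → Measure T)
    [∀ i, IsProbabilityMeasure (μ i)] {f : Fin n → T → ℝ≥0∞} (hf : ∀ i, Measurable (f i)) :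
    ∫⁻ y, ∏ i, f i (y i) ∂(Measure.pi μ) = ∏ i, ∫⁻ y, f i y ∂(μ i) := by
  have hi := ProbabilityTheory.iIndepFun_pi (μ := μ) (X := f) (fun i => (hf i).aemeasurable)
  have h := ProbabilityTheory.lintegral_prod_eq_prod_lintegral_of_indepFun Finset.univ
    (fun (i : Fin n) (y : Fin n → T) => f i (y i)) hi
    (fun i => (hf i).comp (measurable_pi_apply i))
  rw [h]
  refine Finset.prod_congr rfl fun i _ => ?_
  exact (measurePreserving_eval μ i).lintegral_comp (hf i)

variable {S T : Type*} [MeasurableSpace S] [MeasurableSpace T]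

theorem birk_shift (f : S → ℝ) (n : ℕ) (x : ℕ → S) :
    birkhoffSum shiftSeq (fun x : ℕ → S => f (x 0)) n x = ∑ k ∈ Finset.range n, f (x k) := by
  have : ∀ (k : ℕ) (x : ℕ → S) (m : ℕ), (shiftSeq^[k] x) m = x (k + m) := by
    intro k
    induction k with
    | zero => intro x m; simp
    | succ k ih => intro x m; rw [Function.iterate_succ_apply, ih, shiftSeq]; congr 1; ring
  unfold birkhoffSum
  refine Finset.sum_congr rfl fun k _ => ?_
  simp [this]

variable {ρ : S × T → ℝ} {P : Measure S} {Q : Measure T}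
  [IsProbabilityMeasure P] [IsProbabilityMeasure Q] {Psrc : Measure (ℕ → S)}
  [IsProbabilityMeasure Psrc]

theorem src_int (hP1 : Psrc.map (fun x => x 0) = P) {f : S → ℝ} (hfm : Measurable f)
    (hf : Integrable f P) : Integrable (fun x : ℕ → S => f (x 0)) Psrc := by
  rw [← hP1] at hf
  exact (integrable_map_measure hfm.aestronglyMeasurable
    (measurable_pi_apply 0).aemeasurable).1 hf

theorem src_integral (hP1 : Psrc.map (fun x => x 0) = P) {f : S → ℝ} (hfm : Measurable f) :
    ∫ x, f (x 0) ∂Psrc = ∫ x, f x ∂P := by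
  rw [← hP1, integral_map (measurable_pi_apply 0).aemeasurable hfm.aestronglyMeasurable]

theorem src_limit (hErg : Ergodic shiftSeq Psrc) (hP1 : Psrc.map (fun x => x 0) = P)
    {f : S → ℝ} (hfm : Measurable f) (hf : Integrable f P) :
    ∀ᵐ x ∂Psrc, Tendsto (fun n : ℕ => (n : ℝ)⁻¹ * ∑ k ∈ Finset.range n, f (x k)) atTop
      (𝓝 (∫ x, f x ∂P)) := by
  have := birk_limit hErg (hfm.comp (measurable_pi_apply 0)) (src_int hP1 hfm hf)
  rw [← src_integral hP1 hfm]
  filter_upwards [this] with x hx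
  simpa only [Function.comp_def, birk_shift] using hx

theorem src_freq (hErg : Ergodic shiftSeq Psrc) (hP1 : Psrc.map (fun x => x 0) = P)
    {f : S → ℝ} (hfm : Measurable f) (hf : Integrable f P) (h0 : ∫ x, f x ∂P ≤ 0) :
    ∀ᵐ x ∂Psrc, ∃ᶠ n in atTop, ∑ k ∈ Finset.range n, f (x k) ≤ 0 := by
  rw [← src_integral hP1 hfm] at h0
  have := recurrent_freq hErg (hfm.comp (measurable_pi_apply 0)) (src_int hP1 hfm hf) h0
  filter_upwards [this] with x hx
  simpa only [Function.comp_def, birk_shift] using hx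

theorem src_liminf (hErg : Ergodic shiftSeq Psrc) (hP1 : Psrc.map (fun x => x 0) = P)
    {f : S → ℝ} (hfm : Measurable f) (hf : ∀ x, 0 ≤ f x) :
    ∀ᵐ x ∂Psrc, ∫⁻ x, ENNReal.ofReal (f x) ∂P ≤
      liminf (fun n : ℕ => ENNReal.ofReal ((n : ℝ)⁻¹ * ∑ k ∈ Finset.range n, f (x k))) atTop := by
  have := birk_liminf hErg (hfm.comp (measurable_pi_apply 0)) (fun x => hf (x 0))
  have e : ∫⁻ x, ENNReal.ofReal (f x) ∂P = ∫⁻ x, ENNReal.ofReal (f (x 0)) ∂Psrc := by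
    rw [← hP1, lintegral_map hfm.ennreal_ofReal (measurable_pi_apply 0)]
  rw [e]
  filter_upwards [this] with x hx
  simpa only [Function.comp_def, birk_shift] using hx

theorem ball_meas (hρm : Measurable ρ) (D : ℝ) (n : ℕ) (x : ℕ → S) :
    MeasurableSet {y : Fin n → T | rhoFin ρ n (fun k => x k) y ≤ D} := by
  unfold rhoFin
  exact measurableSet_le (by fun_prop) measurable_const

theorem lintegral_exp_eq (hρm : Measurable ρ) (hρ0 : ∀ z, 0 ≤ ρ z) {l : ℝ} (hl : 0 ≤ l) (x : S) :
    ∫⁻ y, ENNReal.ofReal (Real.exp (-(l * ρ (x, y)))) ∂Q =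
      ENNReal.ofReal (Real.exp (-fl ρ Q l x)) := by
  rw [exp_neg_fl hρm hρ0 hl, Zf, ofReal_integral_eq_lintegral_ofReal (exp_int hρm hρ0 hl x)
    (Eventually.of_forall fun y => Real.exp_nonneg _)]

theorem chernoff (hρm : Measurable ρ) (hρ0 : ∀ z, 0 ≤ ρ z) {l : ℝ} (hl : 0 ≤ l) (D : ℝ)
    {n : ℕ} (hn : 0 < n) (x : ℕ → S) :
    ENNReal.ofReal ((n : ℝ)⁻¹ * ∑ k ∈ Finset.range n, fl ρ Q l (x k)) ≤
      LnIID ρ Q D n x + ENNReal.ofReal (l * D) := by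
  have hn' : (0 : ℝ) < n := by exact_mod_cast hn
  set s := ∑ k ∈ Finset.range n, fl ρ Q l (x k) with hs
  have h1 : (Measure.pi fun _ : Fin n => Q) {y | rhoFin ρ n (fun k => x k) y ≤ D} ≤
      ENNReal.ofReal (Real.exp (-(s - l * n * D))) := by
    calc (Measure.pi fun _ : Fin n => Q) {y | rhoFin ρ n (fun k => x k) y ≤ D}
        = ∫⁻ y in {y | rhoFin ρ n (fun k => x k) y ≤ D}, 1 ∂(Measure.pi fun _ : Fin n => Q) := by
          simp
      _ ≤ ∫⁻ y in {y | rhoFin ρ n (fun k => x k) y ≤ D},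
          ENNReal.ofReal (Real.exp (l * n * D)) *
            ∏ k : Fin n, ENNReal.ofReal (Real.exp (-(l * ρ (x k, y k))))
              ∂(Measure.pi fun _ : Fin n => Q) := by
          refine setLIntegral_mono' (ball_meas hρm D n x) fun y hy => ?_
          rw [← ENNReal.ofReal_prod_of_nonneg (fun _ _ => Real.exp_nonneg _), ← Real.exp_sum,
            ← ENNReal.ofReal_mul (Real.exp_nonneg _), ← Real.exp_add, ← ENNReal.ofReal_one]
          refine ENNReal.ofReal_le_ofReal (Real.one_le_exp ?_)
          have hy' : (n : ℝ)⁻¹ * ∑ k : Fin n, ρ (x k, y k) ≤ D := hy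
          rw [inv_mul_le_iff₀ hn'] at hy'
          rw [Finset.sum_neg_distrib, ← Finset.mul_sum]
          nlinarith
      _ ≤ ∫⁻ y, ENNReal.ofReal (Real.exp (l * n * D)) *
            ∏ k : Fin n, ENNReal.ofReal (Real.exp (-(l * ρ (x k, y k))))
              ∂(Measure.pi fun _ : Fin n => Q) := setLIntegral_le_lintegral _ _
      _ = ENNReal.ofReal (Real.exp (l * n * D)) *
            ∏ k : Fin n, ENNReal.ofReal (Real.exp (-fl ρ Q l (x k))) := by
          rw [lintegral_const_mul _ (by fun_prop)]
          congr 1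
          rw [lintegral_pi_prod (fun _ => Q)
            (f := fun k y => ENNReal.ofReal (Real.exp (-(l * ρ (x k, y))))) (fun i => by fun_prop)]
          exact Finset.prod_congr rfl fun k _ => lintegral_exp_eq hρm hρ0 hl _
      _ = ENNReal.ofReal (Real.exp (-(s - l * n * D))) := by
          rw [← ENNReal.ofReal_prod_of_nonneg (fun _ _ => Real.exp_nonneg _), ← Real.exp_sum,
            ← ENNReal.ofReal_mul (Real.exp_nonneg _), ← Real.exp_add, Finset.sum_neg_distrib,
            Fin.sum_univ_eq_sum_range (fun k => fl ρ Q l (x k)) n]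
          congr 2
          ring
  have h2 : ENNReal.ofReal ((n : ℝ)⁻¹ * (s - l * n * D)) ≤ LnIID ρ Q D n x := by
    unfold LnIID
    rw [← inv_mul_ofReal hn]
    gcongr
    exact negLog_ge h1
  have h3 : (n : ℝ)⁻¹ * s = (n : ℝ)⁻¹ * (s - l * n * D) + l * D := by field_simp; ring
  rw [h3]
  exact ENNReal.ofReal_add_le.trans (add_le_add_left h2 _)

theorem liminf_lower_l (hErg : Ergodic shiftSeq Psrc) (hP1 : Psrc.map (fun x => x 0) = P)
    (hρm : Measurable ρ) (hρ0 : ∀ z, 0 ≤ ρ z) {l : ℝ} (hl : 0 ≤ l) (D : ℝ) :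
    ∀ᵐ x ∂Psrc, ∫⁻ x, ENNReal.ofReal (fl ρ Q l x) ∂P - ENNReal.ofReal (l * D) ≤
      liminf (fun n => LnIID ρ Q D n x) atTop := by
  filter_upwards [src_liminf hErg hP1 (fl_meas (Q := Q) hρm l) (fl_nonneg hρm hρ0 hl)] with x hx
  refine le_of_forall_lt fun c hc => ?_
  have hc1 : c + ENNReal.ofReal (l * D) < ∫⁻ x, ENNReal.ofReal (fl ρ Q l x) ∂P :=
    lt_tsub_iff_right.1 hc
  obtain ⟨c', hcc', hc'⟩ := exists_between hc
  have hc2 : c' + ENNReal.ofReal (l * D) < ∫⁻ x, ENNReal.ofReal (fl ρ Q l x) ∂P :=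
    lt_tsub_iff_right.1 hc'
  refine hcc'.trans_le ?_
  refine le_liminf_of_le (by isBoundedDefault) ?_
  filter_upwards [eventually_lt_of_lt_liminf (hc2.trans_le hx), eventually_gt_atTop 0] with n hn hn0
  have := hn.trans_le (chernoff (Q := Q) hρm hρ0 hl D hn0 x)
  exact (ENNReal.add_lt_add_iff_right ENNReal.ofReal_ne_top).1 this |>.le

/-- the dual value -/
def Kd (ρ : S × T → ℝ) (P : Measure S) (Q : Measure T) (D : ℝ) : ℝ≥0∞ :=
  ⨆ l : ℝ≥0, (∫⁻ x, ENNReal.ofReal (fl ρ Q l x) ∂P - ENNReal.ofReal (l * D))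

theorem Kd_le_R (hρm : Measurable ρ) (hρ0 : ∀ z, 0 ≤ ρ z) (D : ℝ) :
    Kd ρ P Q D ≤ Rrate ρ P Q D := by
  refine iSup_le fun l => ?_
  rw [tsub_le_iff_right]
  exact Rrate_ge hρm hρ0 l.2 D

theorem liminf_lower (hErg : Ergodic shiftSeq Psrc) (hP1 : Psrc.map (fun x => x 0) = P)
    (hρm : Measurable ρ) (hρ0 : ∀ z, 0 ≤ ρ z) (D : ℝ) :
    ∀ᵐ x ∂Psrc, Kd ρ P Q D ≤ liminf (fun n => LnIID ρ Q D n x) atTop := by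
  obtain ⟨u, -, hu, hu'⟩ := exists_seq_tendsto_sSup
    (S := range fun l : ℝ≥0 => (∫⁻ x, ENNReal.ofReal (fl ρ Q l x) ∂P - ENNReal.ofReal (l * D)))
    (range_nonempty _) (OrderTop.bddAbove _)
  choose v hv using hu'
  have : ∀ᵐ x ∂Psrc, ∀ k, u k ≤ liminf (fun n => LnIID ρ Q D n x) atTop := by
    rw [ae_all_iff]
    intro k
    rw [← hv k]
    exact liminf_lower_l hErg hP1 hρm hρ0 (v k).2 D
  filter_upwards [this] with x hx
  exact le_of_tendsto' hu hx

theorem neg_case (hρm : Measurable ρ) (hρ0 : ∀ z, 0 ≤ ρ z) {D : ℝ} (hD : D < 0) (x : ℕ → S) :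
    liminf (fun n => LnIID ρ Q D n x) atTop = Rrate ρ P Q D := by
  have h1 : Rrate ρ P Q D = ∞ := by
    unfold Rrate
    refine iInf₂_eq_top.2 fun W hW => ?_
    exfalso
    have h0 : ((0 : ℝ) : EReal) ≤ (D : EReal) := le_trans (EReal.coe_ennreal_nonneg _) hW.2.2
    have : 0 ≤ D := by exact_mod_cast h0
    linarith
  rw [h1, eq_top_iff]
  refine le_liminf_of_le (by isBoundedDefault) ?_
  filter_upwards [eventually_gt_atTop 0] with n hn
  have : {y : Fin n → T | rhoFin ρ n (fun k => x k) y ≤ D} = ∅ := by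
    ext y
    simp only [mem_ofPred_eq, mem_empty_iff_false, iff_false, not_le]
    refine hD.trans_le (mul_nonneg (by positivity) (Finset.sum_nonneg fun k _ => hρ0 _))
  rw [LnIID, this]
  simp [negLog, ENNReal.mul_top]

end Lower

/-! ### Couplings given by conditional densities -/

section Coupling

set_option linter.unusedSectionVars false

variable {S T : Type*} [MeasurableSpace S] [MeasurableSpace T]
variable {ρ : S × T → ℝ} {P : Measure S} {Q : Measure T}
  [IsProbabilityMeasure P] [IsProbabilityMeasure Q]

theorem lintegral_coupling {w : S × T → ℝ} (hw : Measurable w) {φ : S × T → ℝ≥0∞}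
    (hφ : Measurable φ) :
    ∫⁻ z, φ z ∂((P.prod Q).withDensity fun z => ENNReal.ofReal (w z)) =
      ∫⁻ x, ∫⁻ y, ENNReal.ofReal (w (x, y)) * φ (x, y) ∂Q ∂P := by
  rw [lintegral_withDensity_eq_lintegral_mul _ hw.ennreal_ofReal hφ,
    lintegral_prod _ (hw.ennreal_ofReal.mul hφ).aemeasurable]
  rfl

theorem coupling_fst {w : S × T → ℝ} (hw : Measurable w)
    (h1 : ∀ᵐ x ∂P, ∫⁻ y, ENNReal.ofReal (w (x, y)) ∂Q = 1) :
    ((P.prod Q).withDensity fun z => ENNReal.ofReal (w z)).map Prod.fst = P := by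
  ext A hA
  rw [Measure.map_apply measurable_fst hA, ← lintegral_indicator_one (measurable_fst hA),
    lintegral_coupling hw (φ := (Prod.fst ⁻¹' A).indicator 1)
      (measurable_one.indicator (measurable_fst hA)),
    ← lintegral_indicator_one hA]
  refine lintegral_congr_ae ?_
  filter_upwards [h1] with x hx
  by_cases hxA : x ∈ A
  · simp [indicator, hxA, hx]
  · simp [indicator, hxA]

/-- the rate is bounded by the entropy of a coupling with density `w` -/
theorem R_le_coupling (hρm : Measurable ρ) (hρ0 : ∀ z, 0 ≤ ρ z) {w : S × T → ℝ}
    (hw : Measurable w) (hw0 : ∀ z, 0 ≤ w z)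
    (h1 : ∀ᵐ x ∂P, ∫⁻ y, ENNReal.ofReal (w (x, y)) ∂Q = 1) {D : ℝ} (hD : 0 ≤ D)
    (h2 : ∫⁻ z, ENNReal.ofReal (ρ z) ∂((P.prod Q).withDensity fun z => ENNReal.ofReal (w z))
      ≤ ENNReal.ofReal D)
    {e : S × T → ℝ} (he : Integrable e ((P.prod Q).withDensity fun z => ENNReal.ofReal (w z)))
    (hwe : ∀ᵐ z ∂((P.prod Q).withDensity fun z => ENNReal.ofReal (w z)), Real.log (w z) = e z) :
    Rrate ρ P Q D ≤
      ENNReal.ofReal (∫ z, e z ∂((P.prod Q).withDensity fun z => ENNReal.ofReal (w z))) := by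
  set W := (P.prod Q).withDensity fun z => ENNReal.ofReal (w z) with hW
  have hfst : W.map Prod.fst = P := coupling_fst hw h1
  have hWp : IsProbabilityMeasure W := by
    constructor
    have : W.map Prod.fst univ = 1 := by rw [hfst]; simp
    rwa [Measure.map_apply measurable_fst MeasurableSet.univ, preimage_univ] at this
  have hmem : W ∈ distSet ρ P D := by
    refine ⟨hWp, hfst, ?_⟩
    rw [← EReal.coe_ennreal_le_coe_ennreal_iff, EReal.coe_ennreal_ofReal, max_eq_left hD] at h2
    exact h2
  refine (iInf₂_le W hmem).trans ?_
  have hac : W ≪ P.prod Q := withDensity_absolutelyContinuous _ _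
  have hl : llr W (P.prod Q) =ᵐ[W] e := by
    have h3 : W.rnDeriv (P.prod Q) =ᵐ[P.prod Q] fun z => ENNReal.ofReal (w z) :=
      Measure.rnDeriv_withDensity _ hw.ennreal_ofReal
    filter_upwards [hac.ae_le h3, hwe] with z hz hz2
    rw [llr, hz, ENNReal.toReal_ofReal (hw0 z), hz2]
  rw [relEnt, if_pos ⟨hac, he.congr hl.symm⟩, integral_congr_ae hl]

theorem lintegral_wl (hρm : Measurable ρ) (hρ0 : ∀ z, 0 ≤ ρ z) {l : ℝ} (hl : 0 ≤ l) (x : S) :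
    ∫⁻ y, ENNReal.ofReal (wl ρ Q l (x, y)) ∂Q = 1 := by
  have hi := (exp_int (Q := Q) hρm hρ0 hl x).div_const (Zf ρ Q l x)
  unfold wl
  rw [← ofReal_integral_eq_lintegral_ofReal hi
    (Eventually.of_forall fun y => div_nonneg (Real.exp_nonneg _)
      (Zf_pos hρm hρ0 hl x).le), integral_div]
  rw [← ENNReal.ofReal_one]
  congr 1
  exact div_self (Zf_pos (Q := Q) hρm hρ0 hl x).ne'

theorem lintegral_rho_wl (hρm : Measurable ρ) (hρ0 : ∀ z, 0 ≤ ρ z) {l : ℝ} (hl : 0 < l) (x : S) :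
    ∫⁻ y, ENNReal.ofReal (wl ρ Q l (x, y)) * ENNReal.ofReal (ρ (x, y)) ∂Q =
      ENNReal.ofReal (ml ρ Q l x) := by
  have hi := (rho_exp_int (Q := Q) hρm hρ0 hl x).div_const (Zf ρ Q l x)
  have hZ := (Zf_pos (Q := Q) hρm hρ0 hl.le x).le
  rw [ml, ← integral_div, ofReal_integral_eq_lintegral_ofReal hi
    (Eventually.of_forall fun y => div_nonneg (mul_nonneg (hρ0 _) (Real.exp_nonneg _)) hZ)]
  refine lintegral_congr fun y => ?_
  simp only [wl]
  rw [← ENNReal.ofReal_mul (div_nonneg (Real.exp_nonneg _) hZ)]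
  congr 1
  ring

theorem wl_nonneg (hρm : Measurable ρ) (hρ0 : ∀ z, 0 ≤ ρ z) {l : ℝ} (hl : 0 ≤ l) (z : S × T) :
    0 ≤ wl ρ Q l z := by rw [wl_eq hρm hρ0 hl]; positivity

theorem R_le_tilt (hρm : Measurable ρ) (hρ0 : ∀ z, 0 ≤ ρ z) {l : ℝ} (hl : 0 < l)
    (hF : Integrable (fl ρ Q l) P) {D : ℝ} (hD : ∫ x, ml ρ Q l x ∂P ≤ D) :
    Rrate ρ P Q D ≤ ENNReal.ofReal (∫ x, fl ρ Q l x ∂P - l * ∫ x, ml ρ Q l x ∂P) := by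
  have hm0 := ml_nonneg (Q := Q) hρm hρ0 hl.le
  have hmi := ml_int hρm hρ0 hl hF
  have hwm := wl_meas (Q := Q) hρm l
  have h1 : ∀ᵐ x ∂P, ∫⁻ y, ENNReal.ofReal (wl ρ Q l (x, y)) ∂Q = 1 :=
    Eventually.of_forall (lintegral_wl hρm hρ0 hl.le)
  set W := (P.prod Q).withDensity fun z => ENNReal.ofReal (wl ρ Q l z) with hW
  have hfst : W.map Prod.fst = P := coupling_fst hwm h1
  have h2 : ∫⁻ z, ENNReal.ofReal (ρ z) ∂W = ENNReal.ofReal (∫ x, ml ρ Q l x ∂P) := by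
    rw [hW, lintegral_coupling hwm hρm.ennreal_ofReal,
      lintegral_congr (lintegral_rho_wl hρm hρ0 hl),
      ofReal_integral_eq_lintegral_ofReal hmi (Eventually.of_forall hm0)]
  have hρi : Integrable ρ W := by
    refine ⟨hρm.aestronglyMeasurable, ?_⟩
    rw [hasFiniteIntegral_iff_ofReal (Eventually.of_forall hρ0), h2]
    exact ENNReal.ofReal_lt_top
  have hρI : ∫ z, ρ z ∂W = ∫ x, ml ρ Q l x ∂P := by
    rw [integral_eq_lintegral_of_nonneg_ae (Eventually.of_forall hρ0) hρm.aestronglyMeasurable,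
      h2, ENNReal.toReal_ofReal (integral_nonneg hm0)]
  have hfm := fl_meas (Q := Q) hρm l
  have hfi : Integrable (fun z : S × T => fl ρ Q l z.1) W := by
    rw [← hfst] at hF
    exact (integrable_map_measure hfm.aestronglyMeasurable measurable_fst.aemeasurable).1 hF
  have hfI : ∫ z : S × T, fl ρ Q l z.1 ∂W = ∫ x, fl ρ Q l x ∂P := by
    conv_rhs => rw [← hfst]
    rw [integral_map measurable_fst.aemeasurable hfm.aestronglyMeasurable]
  have hdD : 0 ≤ D := (integral_nonneg hm0).trans hD
  have h3 : Integrable (fun z : S × T => fl ρ Q l z.1 - l * ρ z) W := hfi.sub (hρi.const_mul l)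
  have := R_le_coupling (P := P) (Q := Q) hρm hρ0 hwm (wl_nonneg hρm hρ0 hl.le) h1 hdD
    (h2.le.trans (ENNReal.ofReal_le_ofReal hD)) (e := fun z => fl ρ Q l z.1 - l * ρ z) h3 ?_
  · rwa [integral_sub hfi (hρi.const_mul l), integral_const_mul, hfI, hρI] at this
  · refine Eventually.of_forall fun z => ?_
    rw [wl_eq hρm hρ0 hl.le, Real.log_exp]; ring

/-- finiteness consequences of a finite dual value -/
theorem Kd_fin (hρm : Measurable ρ) (hρ0 : ∀ z, 0 ≤ ρ z) {D : ℝ} (hK : Kd ρ P Q D ≠ ∞)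
    {l : ℝ} (hl : 0 ≤ l) :
    Integrable (fl ρ Q l) P ∧ (0 ≤ D → ∫ x, fl ρ Q l x ∂P ≤ (Kd ρ P Q D).toReal + l * D) := by
  have h1 : ∫⁻ x, ENNReal.ofReal (fl ρ Q l x) ∂P ≤ Kd ρ P Q D + ENNReal.ofReal (l * D) := by
    rw [← tsub_le_iff_right]
    exact le_iSup (fun l : ℝ≥0 => (∫⁻ x, ENNReal.ofReal (fl ρ Q l x) ∂P - ENNReal.ofReal (l * D)))
      ⟨l, hl⟩
  have h2 := h1.trans_lt (ENNReal.add_lt_top.2 ⟨hK.lt_top, ENNReal.ofReal_lt_top⟩)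
  have h0 := fl_nonneg (Q := Q) hρm hρ0 hl
  have hm := (fl_meas (Q := Q) hρm l).aestronglyMeasurable (μ := P)
  refine ⟨⟨hm, ?_⟩, fun hD => ?_⟩
  · rw [hasFiniteIntegral_iff_ofReal (Eventually.of_forall h0)]
    exact h2
  · rw [integral_eq_lintegral_of_nonneg_ae (Eventually.of_forall h0) hm]
    have := ENNReal.toReal_mono (ENNReal.add_ne_top.2 ⟨hK, ENNReal.ofReal_ne_top⟩) h1
    rwa [ENNReal.toReal_add hK ENNReal.ofReal_ne_top,
      ENNReal.toReal_ofReal (mul_nonneg hl hD)] at this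

/-- choice of the tilting parameter in the interior case -/
theorem exists_tilt (hρm : Measurable ρ) (hρ0 : ∀ z, 0 ≤ ρ z) {D : ℝ} (hD : 0 ≤ D)
    (hK : Kd ρ P Q D ≠ ∞) {l₀ : ℝ} (hl₀ : 0 < l₀) (hd : ∫ x, ml ρ Q l₀ x ∂P < D) {ε : ℝ}
    (hε : 0 < ε) :
    ∃ l, 0 < l ∧ ∫ x, ml ρ Q l x ∂P < D ∧
      ∫ x, fl ρ Q l x ∂P - l * ∫ x, ml ρ Q l x ∂P ≤ (Kd ρ P Q D).toReal + ε := by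
  suffices h : ∃ l, 0 < l ∧ ∫ x, ml ρ Q l x ∂P < D ∧ l * (D - ∫ x, ml ρ Q l x ∂P) ≤ ε by
    obtain ⟨l, hl, h1, h2⟩ := h
    refine ⟨l, hl, h1, ?_⟩
    have := (Kd_fin (P := P) (Q := Q) hρm hρ0 hK hl.le).2 hD
    linarith
  by_cases hc : l₀ * (D - ∫ x, ml ρ Q l₀ x ∂P) ≤ ε
  · exact ⟨l₀, hl₀, hd, hc⟩
  push Not at hc
  have hD' : 0 < D := lt_of_le_of_lt (integral_nonneg (ml_nonneg hρm hρ0 hl₀.le)) hd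
  set a := min l₀ (ε / 2 / D) with ha
  have ha0 : 0 < a := lt_min hl₀ (by positivity)
  have hal : a ≤ l₀ := min_le_left _ _
  have hcont := dl_cont (P := P) (Q := Q) hρm hρ0 ha0 (Kd_fin (P := P) (Q := Q) hρm hρ0 hK hl₀.le).1
  have hcont2 : ContinuousOn (fun l => l * (D - ∫ x, ml ρ Q l x ∂P)) (Icc a l₀) :=
    continuousOn_id.mul (continuousOn_const.sub hcont)
  have hea : a * (D - ∫ x, ml ρ Q a x ∂P) ≤ ε / 2 := by
    have h1 : 0 ≤ ∫ x, ml ρ Q a x ∂P := integral_nonneg (ml_nonneg hρm hρ0 ha0.le)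
    have h2 : a * D ≤ ε / 2 := by
      rw [← le_div_iff₀ hD']; exact min_le_right _ _
    nlinarith
  obtain ⟨l, hl, hle⟩ := intermediate_value_Icc hal hcont2
    (show ε / 2 + ε / 4 ∈ Icc _ _ from ⟨by linarith, by linarith⟩)
  have hl0 : 0 < l := ha0.trans_le hl.1
  simp only at hle
  refine ⟨l, hl0, ?_, by linarith⟩
  by_contra hcon
  push Not at hcon
  nlinarith

end Coupling

/-! ### The upper bound in the interior case -/

section UpperTilt

set_option linter.unusedSectionVars false

variable {S T : Type*} [MeasurableSpace S] [MeasurableSpace T]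
variable {ρ : S × T → ℝ} {P : Measure S} {Q : Measure T}
  [IsProbabilityMeasure P] [IsProbabilityMeasure Q] {Psrc : Measure (ℕ → S)}
  [IsProbabilityMeasure Psrc]

/-- tangent line inequality for the concave function `l ↦ fl l x` -/
theorem fl_tangent (hρm : Measurable ρ) (hρ0 : ∀ z, 0 ≤ ρ z) {a b : ℝ} (ha : 0 < a) (hb : 0 ≤ b)
    (x : S) : fl ρ Q b x ≤ fl ρ Q a x + (b - a) * ml ρ Q a x := by
  have hZ := Zf_pos (Q := Q) hρm hρ0 ha.le x
  set m := ml ρ Q a x with hm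
  have hmZ : ∫ y, ρ (x, y) * Real.exp (-(a * ρ (x, y))) ∂Q = m * Zf ρ Q a x := by
    rw [hm, ml, div_mul_cancel₀ _ hZ.ne']
  have i1 := exp_int (Q := Q) hρm hρ0 ha.le x
  have i2 := rho_exp_int (Q := Q) hρm hρ0 ha x
  have key : Real.exp (-((b - a) * m)) * Zf ρ Q a x ≤ Zf ρ Q b x := by
    have h1 : ∫ y, (Real.exp (-((b - a) * m)) * (1 + (b - a) * m) * Real.exp (-(a * ρ (x, y)))
        - Real.exp (-((b - a) * m)) * (b - a) * (ρ (x, y) * Real.exp (-(a * ρ (x, y))))) ∂Q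
        ≤ Zf ρ Q b x := by
      refine integral_mono ((i1.const_mul _).sub (i2.const_mul _)) (exp_int hρm hρ0 hb x) fun y => ?_
      simp only
      have h2 := Real.add_one_le_exp (-((b - a) * ρ (x, y)) + (b - a) * m)
      have h3 : Real.exp (-(b * ρ (x, y))) = Real.exp (-((b - a) * m)) *
          Real.exp (-(a * ρ (x, y))) * Real.exp (-((b - a) * ρ (x, y)) + (b - a) * m) := by
        rw [← Real.exp_add, ← Real.exp_add]; congr 1; ring
      rw [h3]
      have h4 : 0 < Real.exp (-((b - a) * m)) * Real.exp (-(a * ρ (x, y))) := by positivity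
      nlinarith
    rw [integral_sub (i1.const_mul _) (i2.const_mul _), integral_const_mul, integral_const_mul,
      hmZ] at h1
    refine le_trans (le_of_eq ?_) h1
    change _ = _ * Zf ρ Q a x - _
    ring
  unfold fl
  have := Real.log_le_log (by positivity) key
  rw [Real.log_mul (Real.exp_pos _).ne' hZ.ne', Real.log_exp] at this
  linarith

theorem lintegral_exp_sum (hρm : Measurable ρ) (hρ0 : ∀ z, 0 ≤ ρ z) {l : ℝ} (hl : 0 ≤ l)
    (n : ℕ) (x : ℕ → S) :
    ∫⁻ y, ENNReal.ofReal (Real.exp (-(l * ∑ k : Fin n, ρ (x k, y k))))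
      ∂(Measure.pi fun _ : Fin n => Q) =
      ENNReal.ofReal (Real.exp (-∑ k ∈ Finset.range n, fl ρ Q l (x k))) := by
  calc ∫⁻ y, ENNReal.ofReal (Real.exp (-(l * ∑ k : Fin n, ρ (x k, y k))))
      ∂(Measure.pi fun _ : Fin n => Q)
      = ∫⁻ y, ∏ k : Fin n, ENNReal.ofReal (Real.exp (-(l * ρ (x k, y k))))
              ∂(Measure.pi fun _ : Fin n => Q) := by
        refine lintegral_congr fun y => ?_
        rw [← ENNReal.ofReal_prod_of_nonneg (fun _ _ => Real.exp_nonneg _), ← Real.exp_sum,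
          Finset.sum_neg_distrib, ← Finset.mul_sum]
    _ = ∏ k : Fin n, ENNReal.ofReal (Real.exp (-fl ρ Q l (x k))) := by
        rw [lintegral_pi_prod (fun _ => Q)
            (f := fun k y => ENNReal.ofReal (Real.exp (-(l * ρ (x k, y))))) (fun i => by fun_prop)]
        exact Finset.prod_congr rfl fun k _ => lintegral_exp_eq hρm hρ0 hl _
    _ = _ := by
        rw [← ENNReal.ofReal_prod_of_nonneg (fun _ _ => Real.exp_nonneg _), ← Real.exp_sum,
          Finset.sum_neg_distrib, Fin.sum_univ_eq_sum_range (fun k => fl ρ Q l (x k)) n]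

/-- finite-`n` window estimate -/
theorem window (hρm : Measurable ρ) (hρ0 : ∀ z, 0 ≤ ρ z) {l θ a b : ℝ} (hθ : 0 < θ) (hl : θ < l)
    {n : ℕ} (x : ℕ → S) :
    ENNReal.ofReal (Real.exp (-∑ k ∈ Finset.range n, fl ρ Q l (x k))) ≤
      ENNReal.ofReal (Real.exp (-(l * a))) *
        (Measure.pi fun _ : Fin n => Q) {y | ∑ k : Fin n, ρ (x k, y k) ≤ b} +
      ENNReal.ofReal (Real.exp (-(θ * b) - ∑ k ∈ Finset.range n, fl ρ Q (l - θ) (x k))) +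
      ENNReal.ofReal (Real.exp (θ * a - ∑ k ∈ Finset.range n, fl ρ Q (l + θ) (x k))) := by
  set μ := (Measure.pi fun _ : Fin n => Q) with hμ
  have hCm : MeasurableSet {y : Fin n → T | ∑ k : Fin n, ρ (x k, y k) ≤ b} :=
    measurableSet_le (by fun_prop) measurable_const
  have e1 : ENNReal.ofReal (Real.exp (-(θ * b) - ∑ k ∈ Finset.range n, fl ρ Q (l - θ) (x k))) =
      ∫⁻ y, ENNReal.ofReal (Real.exp (-(θ * b))) *
        ENNReal.ofReal (Real.exp (-((l - θ) * ∑ k : Fin n, ρ (x k, y k)))) ∂μ := by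
    rw [lintegral_const_mul _ (by fun_prop), lintegral_exp_sum hρm hρ0 (by linarith),
      ← ENNReal.ofReal_mul (Real.exp_nonneg _), ← Real.exp_add, sub_eq_add_neg]
  have e2 : ENNReal.ofReal (Real.exp (θ * a - ∑ k ∈ Finset.range n, fl ρ Q (l + θ) (x k))) =
      ∫⁻ y, ENNReal.ofReal (Real.exp (θ * a)) *
        ENNReal.ofReal (Real.exp (-((l + θ) * ∑ k : Fin n, ρ (x k, y k)))) ∂μ := by
    rw [lintegral_const_mul _ (by fun_prop), lintegral_exp_sum hρm hρ0 (by linarith),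
      ← ENNReal.ofReal_mul (Real.exp_nonneg _), ← Real.exp_add, sub_eq_add_neg]
  have e3 : ENNReal.ofReal (Real.exp (-(l * a))) * μ {y | ∑ k : Fin n, ρ (x k, y k) ≤ b} =
      ∫⁻ y, ({y : Fin n → T | ∑ k : Fin n, ρ (x k, y k) ≤ b}.indicator
        fun _ => ENNReal.ofReal (Real.exp (-(l * a)))) y ∂μ := by
    rw [lintegral_indicator_const hCm]
  rw [← lintegral_exp_sum hρm hρ0 (by linarith : (0:ℝ) ≤ l), e1, e2, e3,
    ← lintegral_add_left (measurable_const.indicator hCm),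
    ← lintegral_add_right _ (by fun_prop)]
  refine lintegral_mono fun y => ?_
  set s := ∑ k : Fin n, ρ (x k, y k) with hs
  rcases lt_or_ge b s with h | h
  · refine le_trans ?_ (le_self_add)
    refine le_trans ?_ (le_add_self)
    rw [← ENNReal.ofReal_mul (Real.exp_nonneg _), ← Real.exp_add]
    refine ENNReal.ofReal_le_ofReal (Real.exp_le_exp.2 ?_)
    nlinarith
  rcases lt_or_ge s a with h' | h'
  · refine le_trans ?_ (le_add_self)
    rw [← ENNReal.ofReal_mul (Real.exp_nonneg _), ← Real.exp_add]
    refine ENNReal.ofReal_le_ofReal (Real.exp_le_exp.2 ?_)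
    nlinarith
  · refine le_trans ?_ (le_self_add)
    refine le_trans ?_ (le_self_add)
    rw [indicator_of_mem (by exact h)]
    refine ENNReal.ofReal_le_ofReal (Real.exp_le_exp.2 ?_)
    nlinarith

theorem upper_det (hρm : Measurable ρ) (hρ0 : ∀ z, 0 ≤ ρ z) {l θ a b : ℝ} (hθ : 0 < θ) (hl : θ < l)
    {n : ℕ} (hn : 0 < n) (x : ℕ → S) {D : ℝ} (hbD : b ≤ n * D)
    (h1 : -(θ * b) - ∑ k ∈ Finset.range n, fl ρ Q (l - θ) (x k) +
      ∑ k ∈ Finset.range n, fl ρ Q l (x k) ≤ -Real.log 4)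
    (h2 : θ * a - ∑ k ∈ Finset.range n, fl ρ Q (l + θ) (x k) +
      ∑ k ∈ Finset.range n, fl ρ Q l (x k) ≤ -Real.log 4) :
    LnIID ρ Q D n x ≤ ENNReal.ofReal ((n : ℝ)⁻¹ *
      (∑ k ∈ Finset.range n, fl ρ Q l (x k) - l * a + Real.log 2)) := by
  have hw := window (Q := Q) hρm hρ0 hθ hl (n := n) (a := a) (b := b) x
  set s := ∑ k ∈ Finset.range n, fl ρ Q l (x k) with hs
  set μ := (Measure.pi fun _ : Fin n => Q) with hμ
  set C := {y : Fin n → T | ∑ k : Fin n, ρ (x k, y k) ≤ b} with hC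
  have hq : μ C ≤ 1 := prob_le_one
  have hq' : μ C ≠ ∞ := (hq.trans_lt ENNReal.one_lt_top).ne
  have hn' : (0 : ℝ) < n := by exact_mod_cast hn
  have hCB : C ⊆ {y | rhoFin ρ n (fun k => x k) y ≤ D} := by
    intro y hy
    change (n : ℝ)⁻¹ * _ ≤ D
    rw [inv_mul_le_iff₀ hn']
    exact le_trans hy hbD
  have e4 : ∀ u : ℝ, u + s ≤ -Real.log 4 → Real.exp u ≤ Real.exp (-s) / 4 := by
    intro u hu
    have : Real.exp (-s) / 4 = Real.exp (-s - Real.log 4) := by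
      rw [Real.exp_sub, Real.exp_log (by norm_num)]
    rw [this]
    exact Real.exp_le_exp.2 (by linarith)
  have hr : Real.exp (-s) ≤ Real.exp (-(l * a)) * (μ C).toReal + Real.exp (-s) / 4 +
      Real.exp (-s) / 4 := by
    have h3 : ENNReal.ofReal (Real.exp (-s)) ≤ ENNReal.ofReal (Real.exp (-(l * a)) * (μ C).toReal +
        Real.exp (-s) / 4 + Real.exp (-s) / 4) := by
      rw [ENNReal.ofReal_add (by positivity) (by positivity),
        ENNReal.ofReal_add (by positivity) (by positivity),
        ENNReal.ofReal_mul (Real.exp_nonneg _), ENNReal.ofReal_toReal hq']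
      refine hw.trans ?_
      gcongr
      · exact e4 _ h1
      · exact e4 _ h2
    exact (ENNReal.ofReal_le_ofReal_iff (by positivity)).1 h3
  have hlow : Real.exp (-(s - l * a + Real.log 2)) ≤ (μ C).toReal := by
    have : Real.exp (-(s - l * a + Real.log 2)) = Real.exp (-s) / 2 / Real.exp (-(l * a)) := by
      rw [← Real.exp_log (show (0:ℝ) < 2 by norm_num), ← Real.exp_sub, ← Real.exp_sub,
        Real.exp_log (by norm_num)]
      congr 1; ring
    rw [this, div_le_iff₀ (Real.exp_pos _)]
    linarith
  unfold LnIID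
  rw [← inv_mul_ofReal hn]
  gcongr
  refine negLog_le ?_ prob_le_one
  refine le_trans ?_ (measure_mono hCB)
  rw [ENNReal.ofReal_le_iff_le_toReal hq']
  exact hlow

theorem upper_tilt (hErg : Ergodic shiftSeq Psrc) (hP1 : Psrc.map (fun x => x 0) = P)
    (hρm : Measurable ρ) (hρ0 : ∀ z, 0 ≤ ρ z) (hF : ∀ l, 0 ≤ l → Integrable (fl ρ Q l) P)
    {l : ℝ} (hl : 0 < l) {D : ℝ} (hD : ∫ x, ml ρ Q l x ∂P < D) {η : ℝ} (hη : 0 < η) :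
    ∀ᵐ x ∂Psrc, ∀ᶠ n in atTop, LnIID ρ Q D n x ≤
      ENNReal.ofReal (∫ x, fl ρ Q l x ∂P - l * ∫ x, ml ρ Q l x ∂P + η) := by
  set d := ∫ x, ml ρ Q l x ∂P with hd
  obtain ⟨δ, hδ0, hδD, hδη⟩ : ∃ δ : ℝ, 0 < δ ∧ d + δ ≤ D ∧ l * δ ≤ η / 2 := by
    refine ⟨min (D - d) (η / 2 / l), lt_min (by linarith) (by positivity), ?_, ?_⟩
    · linarith [min_le_left (D - d) (η / 2 / l)]
    · have := min_le_right (D - d) (η / 2 / l)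
      rw [le_div_iff₀ hl] at this
      linarith
  have hcont : ContinuousAt (fun l => ∫ x, ml ρ Q l x ∂P) l :=
    (dl_cont (P := P) (Q := Q) hρm hρ0 (half_pos hl) (hF (2 * l) (by linarith))).continuousAt
      (Icc_mem_nhds (by linarith) (by linarith))
  obtain ⟨r, hr0, hr⟩ := Metric.continuousAt_iff.1 hcont δ hδ0
  obtain ⟨θ, hθ0, hθl, hθr⟩ : ∃ θ : ℝ, 0 < θ ∧ θ < l ∧ θ < r := by
    refine ⟨min l r / 2, by positivity, ?_, ?_⟩
    · linarith [min_le_left l r, lt_min hl hr0]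
    · linarith [min_le_right l r, lt_min hl hr0]
  have hm1 := hr (x := l - θ) (by rw [Real.dist_eq, abs_lt]; constructor <;> linarith)
  have hm2 := hr (x := l + θ) (by rw [Real.dist_eq, abs_lt]; constructor <;> linarith)
  rw [Real.dist_eq, abs_lt] at hm1 hm2
  have F0 := hF l hl.le
  have F1 := hF (l - θ) (by linarith)
  have F2 := hF (l + θ) (by linarith)
  have c1 : ∫ x, fl ρ Q l x ∂P ≤ ∫ x, fl ρ Q (l - θ) x ∂P + θ * ∫ x, ml ρ Q (l - θ) x ∂P := by
    have hmi := ml_int (P := P) (Q := Q) hρm hρ0 (by linarith : 0 < l - θ) F1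
    rw [← integral_const_mul, ← integral_add F1 (hmi.const_mul θ)]
    refine integral_mono F0 (F1.add (hmi.const_mul θ)) fun x => ?_
    have := fl_tangent (Q := Q) hρm hρ0 (by linarith : 0 < l - θ) hl.le x
    simpa using this
  have c2 : ∫ x, fl ρ Q l x ∂P ≤ ∫ x, fl ρ Q (l + θ) x ∂P - θ * ∫ x, ml ρ Q (l + θ) x ∂P := by
    have hmi := ml_int (P := P) (Q := Q) hρm hρ0 (by linarith : 0 < l + θ) F2
    rw [← integral_const_mul, ← integral_sub F2 (hmi.const_mul θ)]
    refine integral_mono F0 (F2.sub (hmi.const_mul θ)) fun x => ?_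
    have := fl_tangent (Q := Q) hρm hρ0 (by linarith : 0 < l + θ) hl.le x
    simp only [Pi.sub_apply]
    linarith
  filter_upwards [src_limit hErg hP1 (fl_meas (Q := Q) hρm l) F0,
    src_limit hErg hP1 (fl_meas (Q := Q) hρm (l - θ)) F1,
    src_limit hErg hP1 (fl_meas (Q := Q) hρm (l + θ)) F2] with x L0 L1 L2
  have hinv : Tendsto (fun n : ℕ => (n : ℝ)⁻¹) atTop (𝓝 0) := tendsto_inv_atTop_nhds_zero_nat
  have T1 := (L0.sub L1).add (hinv.mul_const (Real.log 4))
  have T2 := (L0.sub L2).add (hinv.mul_const (Real.log 4))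
  have T0 := L0.add (hinv.mul_const (Real.log 2))
  have E1 := T1.eventually (gt_mem_nhds (show _ < θ * (d + δ) by nlinarith))
  have E2 := T2.eventually (gt_mem_nhds (show _ < -(θ * (d - δ)) by nlinarith))
  have E0 := T0.eventually (gt_mem_nhds (show _ < ∫ x, fl ρ Q l x ∂P + η / 2 by linarith))
  filter_upwards [E0, E1, E2, eventually_gt_atTop 0] with n e0 e1 e2 hn
  have hn' : (0 : ℝ) < n := by exact_mod_cast hn
  rw [← mul_sub, ← mul_add, inv_mul_lt_iff₀ hn'] at e1 e2
  have := upper_det (Q := Q) hρm hρ0 hθ0 hθl hn x (a := n * (d - δ)) (b := n * (d + δ)) (D := D)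
    (by gcongr) (by linarith) (by linarith)
  refine this.trans (ENNReal.ofReal_le_ofReal ?_)
  have e3 : (n : ℝ)⁻¹ * (∑ k ∈ Finset.range n, fl ρ Q l (x k) - l * (n * (d - δ)) + Real.log 2) =
      (n : ℝ)⁻¹ * ∑ k ∈ Finset.range n, fl ρ Q l (x k) + (n : ℝ)⁻¹ * Real.log 2 - l * (d - δ) := by
    field_simp
    ring
  rw [e3]
  nlinarith

theorem case_interior (hErg : Ergodic shiftSeq Psrc) (hP1 : Psrc.map (fun x => x 0) = P)
    (hρm : Measurable ρ) (hρ0 : ∀ z, 0 ≤ ρ z) {D : ℝ} (hD : 0 ≤ D) (hK : Kd ρ P Q D ≠ ∞)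
    {l₀ : ℝ} (hl₀ : 0 < l₀) (hd : ∫ x, ml ρ Q l₀ x ∂P < D) :
    Rrate ρ P Q D ≤ Kd ρ P Q D ∧
    ∀ᵐ x ∂Psrc, liminf (fun n => LnIID ρ Q D n x) atTop ≤ Kd ρ P Q D := by
  have hF : ∀ l, 0 ≤ l → Integrable (fl ρ Q l) P := fun l hl =>
    (Kd_fin (P := P) (Q := Q) hρm hρ0 hK hl).1
  have hlim : Tendsto (fun m : ℕ => ENNReal.ofReal ((Kd ρ P Q D).toReal + 1 / ((m : ℝ) + 1)))
      atTop (𝓝 (Kd ρ P Q D)) := by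
    have h1 : Tendsto (fun m : ℕ => (Kd ρ P Q D).toReal + 1 / ((m : ℝ) + 1)) atTop
        (𝓝 ((Kd ρ P Q D).toReal + 0)) :=
      tendsto_const_nhds.add tendsto_one_div_add_atTop_nhds_zero_nat
    have h2 := ENNReal.tendsto_ofReal h1
    rwa [add_zero, ENNReal.ofReal_toReal hK] at h2
  constructor
  · refine ge_of_tendsto' hlim fun m => ?_
    obtain ⟨l, hl, h1, h2⟩ := exists_tilt (P := P) (Q := Q) hρm hρ0 hD hK hl₀ hd
      (show (0:ℝ) < 1 / ((m : ℝ) + 1) by positivity)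
    exact (R_le_tilt hρm hρ0 hl (hF l hl.le) h1.le).trans (ENNReal.ofReal_le_ofReal h2)
  · have : ∀ᵐ x ∂Psrc, ∀ m : ℕ, liminf (fun n => LnIID ρ Q D n x) atTop ≤
        ENNReal.ofReal ((Kd ρ P Q D).toReal + 1 / ((m : ℝ) + 1)) := by
      rw [ae_all_iff]
      intro m
      have hp : (0:ℝ) < 1 / ((m : ℝ) + 1) := by positivity
      obtain ⟨l, hl, h1, h2⟩ := exists_tilt (P := P) (Q := Q) hρm hρ0 hD hK hl₀ hd (half_pos hp)
      filter_upwards [upper_tilt hErg hP1 hρm hρ0 hF hl h1 (half_pos hp)] with x hx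
      refine liminf_le_of_frequently_le' ?_
      refine (hx.mono fun n hn => hn.trans (ENNReal.ofReal_le_ofReal ?_)).frequently
      linarith
    filter_upwards [this] with x hx
    exact ge_of_tendsto' hlim hx

end UpperTilt

/-! ### The boundary case -/

section Boundary

set_option linter.unusedSectionVars false

variable {S T : Type*} [MeasurableSpace S] [MeasurableSpace T]
variable {ρ : S × T → ℝ} {P : Measure S} {Q : Measure T}
  [IsProbabilityMeasure P] [IsProbabilityMeasure Q] {Psrc : Measure (ℕ → S)}
  [IsProbabilityMeasure Psrc]

/-- essential infimum of `ρ (x, ·)`, as a limit of scaled log-partition functions -/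
def gi (ρ : S × T → ℝ) (Q : Measure T) (x : S) : ℝ :=
  ⨅ n : ℕ, fl ρ Q ((n : ℝ) + 1) x / ((n : ℝ) + 1)

/-- probability of (nearly) attaining the essential infimum -/
def qi (ρ : S × T → ℝ) (Q : Measure T) (x : S) : ℝ := Q.real {y | ρ (x, y) ≤ gi ρ Q x}

theorem fl_div_anti (hρm : Measurable ρ) (hρ0 : ∀ z, 0 ≤ ρ z) (x : S) :
    Antitone fun n : ℕ => fl ρ Q ((n : ℝ) + 1) x / ((n : ℝ) + 1) := by
  intro n m hnm
  have hnm' : (n : ℝ) + 1 ≤ (m : ℝ) + 1 := by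
    have : (n : ℝ) ≤ m := by exact_mod_cast hnm
    linarith
  have hn : (0 : ℝ) < (n : ℝ) + 1 := by positivity
  have hm : (0 : ℝ) < (m : ℝ) + 1 := by positivity
  have h1 := fl_tangent (Q := Q) hρm hρ0 hn hm.le x
  have h2 := mul_ml_le (Q := Q) hρm hρ0 hn x
  simp only
  rw [div_le_div_iff₀ hm hn]
  have h3 := mul_le_mul_of_nonneg_left h2 (sub_nonneg.2 hnm')
  have h4 := mul_le_mul_of_nonneg_right h1 hn.le
  nlinarith

theorem fl_div_nonneg (hρm : Measurable ρ) (hρ0 : ∀ z, 0 ≤ ρ z) (x : S) (n : ℕ) :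
    0 ≤ fl ρ Q ((n : ℝ) + 1) x / ((n : ℝ) + 1) :=
  div_nonneg (fl_nonneg hρm hρ0 (by positivity) x) (by positivity)

theorem fl_div_bdd (hρm : Measurable ρ) (hρ0 : ∀ z, 0 ≤ ρ z) (x : S) :
    BddBelow (range fun n : ℕ => fl ρ Q ((n : ℝ) + 1) x / ((n : ℝ) + 1)) :=
  ⟨0, by rintro _ ⟨n, rfl⟩; exact fl_div_nonneg hρm hρ0 x n⟩

theorem gi_nonneg (hρm : Measurable ρ) (hρ0 : ∀ z, 0 ≤ ρ z) (x : S) : 0 ≤ gi ρ Q x :=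
  le_ciInf (fl_div_nonneg hρm hρ0 x)

theorem gi_le (hρm : Measurable ρ) (hρ0 : ∀ z, 0 ≤ ρ z) (x : S) (n : ℕ) :
    ((n : ℝ) + 1) * gi ρ Q x ≤ fl ρ Q ((n : ℝ) + 1) x := by
  have := ciInf_le (fl_div_bdd (Q := Q) hρm hρ0 x) n
  rw [le_div_iff₀ (by positivity)] at this
  rw [mul_comm]
  exact this

theorem gi_tendsto (hρm : Measurable ρ) (hρ0 : ∀ z, 0 ≤ ρ z) (x : S) :
    Tendsto (fun n : ℕ => fl ρ Q ((n : ℝ) + 1) x / ((n : ℝ) + 1)) atTop (𝓝 (gi ρ Q x)) :=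
  tendsto_atTop_ciInf (fl_div_anti hρm hρ0 x) (fl_div_bdd hρm hρ0 x)

theorem gi_meas (hρm : Measurable ρ) (hρ0 : ∀ z, 0 ≤ ρ z) : Measurable (gi ρ Q) :=
  measurable_of_tendsto_metrizable (fun n : ℕ => (fl_meas (Q := Q) hρm ((n : ℝ) + 1)).div_const _)
    (tendsto_pi_nhds.2 (gi_tendsto hρm hρ0))

theorem gi_set_meas (hρm : Measurable ρ) (hρ0 : ∀ z, 0 ≤ ρ z) :
    MeasurableSet {z : S × T | ρ z ≤ gi ρ Q z.1} :=
  measurableSet_le hρm ((gi_meas hρm hρ0).comp measurable_fst)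

theorem qi_meas (hρm : Measurable ρ) (hρ0 : ∀ z, 0 ≤ ρ z) : Measurable (qi ρ Q) :=
  (measurable_measure_prodMk_left (ν := Q) (gi_set_meas hρm hρ0)).ennreal_toReal

theorem integral_exp_gap (hρm : Measurable ρ) (hρ0 : ∀ z, 0 ≤ ρ z) (x : S) (n : ℕ) :
    ∫ y, Real.exp (-(((n : ℝ) + 1) * (ρ (x, y) - gi ρ Q x))) ∂Q =
      Real.exp (-(fl ρ Q ((n : ℝ) + 1) x - ((n : ℝ) + 1) * gi ρ Q x)) := by
  have h1 : ∀ y, Real.exp (-(((n : ℝ) + 1) * (ρ (x, y) - gi ρ Q x))) =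
      Real.exp (((n : ℝ) + 1) * gi ρ Q x) * Real.exp (-(((n : ℝ) + 1) * ρ (x, y))) := by
    intro y
    rw [← Real.exp_add]; congr 1; ring
  simp_rw [h1]
  rw [integral_const_mul]
  change _ * Zf ρ Q ((n : ℝ) + 1) x = _
  rw [← exp_neg_fl hρm hρ0 (by positivity), ← Real.exp_add]
  congr 1; ring

theorem int_exp_gap (hρm : Measurable ρ) (hρ0 : ∀ z, 0 ≤ ρ z) (x : S) (n : ℕ) :
    Integrable (fun y => Real.exp (-(((n : ℝ) + 1) * (ρ (x, y) - gi ρ Q x)))) Q := by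
  have h1 : ∀ y, Real.exp (-(((n : ℝ) + 1) * (ρ (x, y) - gi ρ Q x))) =
      Real.exp (((n : ℝ) + 1) * gi ρ Q x) * Real.exp (-(((n : ℝ) + 1) * ρ (x, y))) := by
    intro y
    rw [← Real.exp_add]; congr 1; ring
  simp_rw [h1]
  exact (exp_int hρm hρ0 (by positivity) x).const_mul _

theorem gi_le_ae (hρm : Measurable ρ) (hρ0 : ∀ z, 0 ≤ ρ z) (x : S) :
    ∀ᵐ y ∂Q, gi ρ Q x ≤ ρ (x, y) := by
  have h : ∀ j : ℕ, ∀ᵐ y ∂Q, gi ρ Q x - 1 / ((j : ℝ) + 1) < ρ (x, y) := by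
    intro j
    set e : ℝ := 1 / ((j : ℝ) + 1) with he
    have he0 : 0 < e := by positivity
    have hb : ∀ n : ℕ, Q.real {y | ρ (x, y) ≤ gi ρ Q x - e} ≤ Real.exp (-(((n : ℝ) + 1) * e)) := by
      intro n
      have h1 := mul_meas_ge_le_integral_of_nonneg
        (Eventually.of_forall fun y => Real.exp_nonneg _) (int_exp_gap (Q := Q) hρm hρ0 x n)
        (Real.exp (((n : ℝ) + 1) * e))
      rw [integral_exp_gap hρm hρ0] at h1
      have h2 : Real.exp (-(fl ρ Q ((n : ℝ) + 1) x - ((n : ℝ) + 1) * gi ρ Q x)) ≤ 1 := by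
        rw [Real.exp_le_one_iff]
        linarith [gi_le (Q := Q) hρm hρ0 x n]
      have h3 : Q.real {y | ρ (x, y) ≤ gi ρ Q x - e} ≤
          Q.real {y | Real.exp (((n : ℝ) + 1) * e) ≤
            Real.exp (-(((n : ℝ) + 1) * (ρ (x, y) - gi ρ Q x)))} := by
        refine measureReal_mono fun y hy => ?_
        have hy' : ρ (x, y) ≤ gi ρ Q x - e := hy
        refine Real.exp_le_exp.2 ?_
        have : (0:ℝ) < (n : ℝ) + 1 := by positivity
        nlinarith
      rw [Real.exp_neg, ← one_div, le_div_iff₀ (Real.exp_pos _)]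
      have := mul_le_mul_of_nonneg_left h3 (Real.exp_nonneg (((n : ℝ) + 1) * e))
      linarith
    have hlim : Tendsto (fun n : ℕ => Real.exp (-(((n : ℝ) + 1) * e))) atTop (𝓝 0) := by
      refine Real.tendsto_exp_neg_atTop_nhds_zero.comp ?_
      refine Tendsto.atTop_mul_const he0 ?_
      exact tendsto_atTop_add_const_right _ _ tendsto_natCast_atTop_atTop
    have h0 : Q.real {y | ρ (x, y) ≤ gi ρ Q x - e} = 0 :=
      le_antisymm (ge_of_tendsto' hlim hb) measureReal_nonneg
    rw [measureReal_eq_zero_iff] at h0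
    rw [ae_iff]
    simpa only [not_lt] using h0
  filter_upwards [ae_all_iff.2 h] with y hy
  have hl : Tendsto (fun j : ℕ => gi ρ Q x - 1 / ((j : ℝ) + 1)) atTop (𝓝 (gi ρ Q x - 0)) :=
    tendsto_const_nhds.sub tendsto_one_div_add_atTop_nhds_zero_nat
  rw [sub_zero] at hl
  exact le_of_tendsto' hl fun j => (hy j).le

theorem gap_tendsto (hρm : Measurable ρ) (hρ0 : ∀ z, 0 ≤ ρ z) (x : S) :
    Tendsto (fun n : ℕ => Real.exp (-(fl ρ Q ((n : ℝ) + 1) x - ((n : ℝ) + 1) * gi ρ Q x))) atTop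
      (𝓝 (qi ρ Q x)) := by
  have hsm : MeasurableSet {y | ρ (x, y) ≤ gi ρ Q x} :=
    measurableSet_le (by fun_prop) measurable_const
  have h1 : qi ρ Q x = ∫ y, ({y | ρ (x, y) ≤ gi ρ Q x}.indicator fun _ => (1:ℝ)) y ∂Q := by
    rw [integral_indicator_const _ hsm]; simp [qi]
  rw [h1]
  simp_rw [← integral_exp_gap (Q := Q) hρm hρ0]
  refine tendsto_integral_of_dominated_convergence (fun _ => (1:ℝ))
    (fun n => (int_exp_gap hρm hρ0 x n).aestronglyMeasurable) (integrable_const _) ?_ ?_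
  · intro n
    filter_upwards [gi_le_ae (Q := Q) hρm hρ0 x] with y hy
    rw [Real.norm_eq_abs, abs_of_pos (Real.exp_pos _), Real.exp_le_one_iff]
    have : 0 ≤ ((n : ℝ) + 1) * (ρ (x, y) - gi ρ Q x) := mul_nonneg (by positivity) (by linarith)
    linarith
  · filter_upwards [gi_le_ae (Q := Q) hρm hρ0 x] with y hy
    by_cases hc : ρ (x, y) ≤ gi ρ Q x
    · have he : ρ (x, y) - gi ρ Q x = 0 := by linarith
      simp [indicator, hc, he]
    · have : 0 < ρ (x, y) - gi ρ Q x := by push Not at hc; linarith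
      simp only [indicator, mem_ofPred_eq, hc, if_false]
      refine Real.tendsto_exp_neg_atTop_nhds_zero.comp ?_
      refine Tendsto.atTop_mul_const this ?_
      exact tendsto_atTop_add_const_right _ _ tendsto_natCast_atTop_atTop

theorem gi_int (hρm : Measurable ρ) (hρ0 : ∀ z, 0 ≤ ρ z)
    (hF : Integrable (fl ρ Q 1) P) : Integrable (gi ρ Q) P := by
  refine hF.mono' (gi_meas hρm hρ0).aestronglyMeasurable (Eventually.of_forall fun x => ?_)
  rw [Real.norm_eq_abs, abs_of_nonneg (gi_nonneg hρm hρ0 x)]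
  have := gi_le (Q := Q) hρm hρ0 x 0
  simpa using this

theorem gi_integral (hρm : Measurable ρ) (hρ0 : ∀ z, 0 ≤ ρ z) {D : ℝ} (hD : 0 ≤ D)
    (hK : Kd ρ P Q D ≠ ∞) (hd : ∀ l, 0 < l → D ≤ ∫ x, ml ρ Q l x ∂P) :
    ∫ x, gi ρ Q x ∂P = D := by
  have hF : ∀ l, 0 ≤ l → Integrable (fl ρ Q l) P := fun l hl =>
    (Kd_fin (P := P) (Q := Q) hρm hρ0 hK hl).1
  have hlim : Tendsto (fun n : ℕ => ∫ x, fl ρ Q ((n : ℝ) + 1) x / ((n : ℝ) + 1) ∂P) atTop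
      (𝓝 (∫ x, gi ρ Q x ∂P)) := by
    refine tendsto_integral_of_dominated_convergence (fl ρ Q 1)
      (fun n => ((fl_meas (Q := Q) hρm ((n : ℝ) + 1)).div_const _).aestronglyMeasurable)
      (hF 1 zero_le_one) (fun n => Eventually.of_forall fun x => ?_)
      (Eventually.of_forall (gi_tendsto hρm hρ0))
    rw [Real.norm_eq_abs, abs_of_nonneg (fl_div_nonneg hρm hρ0 x n)]
    have := fl_div_anti (Q := Q) hρm hρ0 x (Nat.zero_le n)
    simpa using this
  simp_rw [integral_div] at hlim
  apply le_antisymm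
  · have h1 : Tendsto (fun n : ℕ => (Kd ρ P Q D).toReal * (1 / ((n : ℝ) + 1)) + D) atTop
        (𝓝 ((Kd ρ P Q D).toReal * 0 + D)) :=
      (tendsto_one_div_add_atTop_nhds_zero_nat.const_mul _).add_const _
    rw [mul_zero, zero_add] at h1
    refine le_of_tendsto_of_tendsto' hlim h1 fun n => ?_
    have hn : (0:ℝ) < (n : ℝ) + 1 := by positivity
    have := (Kd_fin (P := P) (Q := Q) hρm hρ0 hK hn.le).2 hD
    rw [div_le_iff₀ hn]
    have e : ((Kd ρ P Q D).toReal * (1 / ((n : ℝ) + 1)) + D) * ((n : ℝ) + 1) =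
      (Kd ρ P Q D).toReal + ((n : ℝ) + 1) * D := by field_simp
    rw [e]; exact this
  · refine ge_of_tendsto' hlim fun n => ?_
    have hn : (0:ℝ) < (n : ℝ) + 1 := by positivity
    refine (hd _ hn).trans ?_
    rw [le_div_iff₀ hn, mul_comm, ← integral_const_mul]
    exact integral_mono ((ml_int hρm hρ0 hn (hF _ hn.le)).const_mul _) (hF _ hn.le)
      (mul_ml_le hρm hρ0 hn)

theorem qi_le_one (x : S) : qi ρ Q x ≤ 1 := measureReal_le_one

/-- the entropy of the boundary coupling -/
theorem qi_fin (hρm : Measurable ρ) (hρ0 : ∀ z, 0 ≤ ρ z) {D : ℝ} (hD : 0 ≤ D)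
    (hK : Kd ρ P Q D ≠ ∞) (hd : ∀ l, 0 < l → D ≤ ∫ x, ml ρ Q l x ∂P) :
    (∀ᵐ x ∂P, 0 < qi ρ Q x) ∧ Integrable (fun x => -Real.log (qi ρ Q x)) P ∧
      ∫ x, -Real.log (qi ρ Q x) ∂P ≤ (Kd ρ P Q D).toReal := by
  have hF : ∀ l, 0 ≤ l → Integrable (fl ρ Q l) P := fun l hl =>
    (Kd_fin (P := P) (Q := Q) hρm hρ0 hK hl).1
  have hgi := gi_int (P := P) hρm hρ0 (hF 1 zero_le_one)
  have hgI := gi_integral (P := P) hρm hρ0 hD hK hd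
  set h : ℕ → S → ℝ := fun n x => fl ρ Q ((n : ℝ) + 1) x - ((n : ℝ) + 1) * gi ρ Q x with hh
  have hhm : ∀ n, Measurable (h n) := fun n =>
    (fl_meas hρm _).sub ((gi_meas hρm hρ0).const_mul _)
  have hh0 : ∀ n x, 0 ≤ h n x := fun n x => by
    have := gi_le (Q := Q) hρm hρ0 x n
    simp only [hh]; linarith
  have hhi : ∀ n, ∫⁻ x, ENNReal.ofReal (h n x) ∂P ≤ Kd ρ P Q D := by
    intro n
    have hn : (0:ℝ) ≤ (n : ℝ) + 1 := by positivity
    have i1 : Integrable (h n) P := (hF _ hn).sub (hgi.const_mul _)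
    rw [← ofReal_integral_eq_lintegral_ofReal i1 (Eventually.of_forall (hh0 n)),
      ENNReal.ofReal_le_iff_le_toReal hK]
    simp only [hh]
    rw [integral_sub (hF _ hn) (hgi.const_mul _), integral_const_mul, hgI]
    have := (Kd_fin (P := P) (Q := Q) hρm hρ0 hK hn).2 hD
    linarith
  have hfat : ∫⁻ x, liminf (fun n => ENNReal.ofReal (h n x)) atTop ∂P ≤ Kd ρ P Q D := by
    refine (lintegral_liminf_le fun n => (hhm n).ennreal_ofReal).trans ?_
    exact liminf_le_of_frequently_le' (Eventually.of_forall hhi).frequently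
  have hlm : Measurable fun x => liminf (fun n => ENNReal.ofReal (h n x)) atTop :=
    Measurable.liminf fun n => (hhm n).ennreal_ofReal
  have hae : ∀ᵐ x ∂P, liminf (fun n => ENNReal.ofReal (h n x)) atTop < ∞ :=
    ae_lt_top hlm (hfat.trans_lt hK.lt_top).ne
  have key : ∀ x (c : ℝ), liminf (fun n => ENNReal.ofReal (h n x)) atTop < ENNReal.ofReal c →
      Real.exp (-c) ≤ qi ρ Q x := by
    intro x c hc
    have hfr := frequently_lt_of_liminf_lt (by isBoundedDefault) hc
    refine ge_of_tendsto_of_frequently (gap_tendsto (Q := Q) hρm hρ0 x) (hfr.mono fun n hn => ?_)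
    have : h n x < c := by
      by_contra hcon
      push Not at hcon
      exact absurd (ENNReal.ofReal_le_ofReal hcon) (not_le.2 hn)
    refine Real.exp_le_exp.2 ?_
    simp only [hh] at this
    linarith
  have hpos : ∀ᵐ x ∂P, 0 < qi ρ Q x := by
    filter_upwards [hae] with x hx
    refine lt_of_lt_of_le (Real.exp_pos _)
      (key x ((liminf (fun n => ENNReal.ofReal (h n x)) atTop).toReal + 1) ?_)
    rw [ENNReal.lt_ofReal_iff_toReal_lt hx.ne]
    linarith
  have ha0 : ∀ x, 0 ≤ -Real.log (qi ρ Q x) := fun x => by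
    have := Real.log_nonpos (measureReal_nonneg (μ := Q)) (qi_le_one (ρ := ρ) (Q := Q) x)
    exact neg_nonneg.2 this
  have hle : ∀ᵐ x ∂P, ENNReal.ofReal (-Real.log (qi ρ Q x)) ≤
      liminf (fun n => ENNReal.ofReal (h n x)) atTop := by
    filter_upwards [hae, hpos] with x hx hq
    refine le_of_forall_gt fun c hc => ?_
    obtain ⟨c', hc1, hc2⟩ := exists_between hc
    have hc't : c' ≠ ∞ := (hc2.trans_le le_top).ne
    refine lt_of_le_of_lt ?_ hc2
    rw [← ENNReal.ofReal_toReal hc't] at hc1 ⊢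
    refine ENNReal.ofReal_le_ofReal ?_
    have := Real.log_le_log (Real.exp_pos _) (key x _ hc1)
    rw [Real.log_exp] at this
    linarith
  have ham : Measurable fun x => -Real.log (qi ρ Q x) := (qi_meas hρm hρ0).log.neg
  have hI : ∫⁻ x, ENNReal.ofReal (-Real.log (qi ρ Q x)) ∂P ≤ Kd ρ P Q D :=
    (lintegral_mono_ae hle).trans hfat
  refine ⟨hpos, ⟨ham.aestronglyMeasurable, ?_⟩, ?_⟩
  · rw [hasFiniteIntegral_iff_ofReal (Eventually.of_forall ha0)]
    exact hI.trans_lt hK.lt_top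
  · rw [integral_eq_lintegral_of_nonneg_ae (Eventually.of_forall ha0) ham.aestronglyMeasurable]
    exact ENNReal.toReal_mono hK hI

theorem R_le_boundary (hρm : Measurable ρ) (hρ0 : ∀ z, 0 ≤ ρ z) {D : ℝ} (hD : 0 ≤ D)
    (hK : Kd ρ P Q D ≠ ∞) (hd : ∀ l, 0 < l → D ≤ ∫ x, ml ρ Q l x ∂P) :
    Rrate ρ P Q D ≤ Kd ρ P Q D := by
  obtain ⟨hpos, hai, haI⟩ := qi_fin (P := P) hρm hρ0 hD hK hd
  have hF : Integrable (fl ρ Q 1) P := (Kd_fin (P := P) (Q := Q) hρm hρ0 hK zero_le_one).1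
  have hgi := gi_int (P := P) hρm hρ0 hF
  have hgI := gi_integral (P := P) hρm hρ0 hD hK hd
  set w : S × T → ℝ := {z : S × T | ρ z ≤ gi ρ Q z.1}.indicator fun z => (qi ρ Q z.1)⁻¹ with hw
  have hq0 : ∀ x, 0 ≤ qi ρ Q x := fun x => measureReal_nonneg
  have hqm := qi_meas (Q := Q) hρm hρ0
  have hqm' : Measurable fun z : S × T => (qi ρ Q z.1)⁻¹ := (hqm.comp measurable_fst).inv
  have hwm : Measurable w := hqm'.indicator (gi_set_meas hρm hρ0)
  have hw0 : ∀ z, 0 ≤ w z := fun z => indicator_nonneg (fun z _ => inv_nonneg.2 (hq0 _)) z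
  have h1 : ∀ᵐ x ∂P, ∫⁻ y, ENNReal.ofReal (w (x, y)) ∂Q = 1 := by
    filter_upwards [hpos] with x hx
    have hsm : MeasurableSet {y | ρ (x, y) ≤ gi ρ Q x} :=
      measurableSet_le (by fun_prop) measurable_const
    have e : ∀ y, ENNReal.ofReal (w (x, y)) =
        ({y | ρ (x, y) ≤ gi ρ Q x}.indicator fun _ => ENNReal.ofReal (qi ρ Q x)⁻¹) y := by
      intro y
      by_cases hy : ρ (x, y) ≤ gi ρ Q x <;> simp [hw, indicator, hy]
    rw [lintegral_congr e, lintegral_indicator_const hsm]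
    have e2 : Q {y | ρ (x, y) ≤ gi ρ Q x} = ENNReal.ofReal (qi ρ Q x) := by
      rw [qi, ofReal_measureReal]
    rw [e2, ← ENNReal.ofReal_mul (inv_nonneg.2 hx.le), inv_mul_cancel₀ hx.ne', ENNReal.ofReal_one]
  have hfst := coupling_fst hwm h1
  have h2 : ∫⁻ z, ENNReal.ofReal (ρ z) ∂((P.prod Q).withDensity fun z => ENNReal.ofReal (w z))
      ≤ ENNReal.ofReal D := by
    rw [lintegral_coupling hwm hρm.ennreal_ofReal, ← hgI,
      ofReal_integral_eq_lintegral_ofReal hgi (Eventually.of_forall (gi_nonneg hρm hρ0))]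
    refine lintegral_mono_ae ?_
    filter_upwards [h1] with x hx
    calc ∫⁻ y, ENNReal.ofReal (w (x, y)) * ENNReal.ofReal (ρ (x, y)) ∂Q
        ≤ ∫⁻ y, ENNReal.ofReal (w (x, y)) * ENNReal.ofReal (gi ρ Q x) ∂Q := by
          refine lintegral_mono fun y => ?_
          by_cases hy : ρ (x, y) ≤ gi ρ Q x
          · gcongr
          · simp [hw, indicator, hy]
      _ = ENNReal.ofReal (gi ρ Q x) := by
          rw [lintegral_mul_const _ (by fun_prop), hx, one_mul]
  have ham : Measurable fun x => -Real.log (qi ρ Q x) := hqm.log.neg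
  have hei : Integrable (fun z : S × T => -Real.log (qi ρ Q z.1))
      ((P.prod Q).withDensity fun z => ENNReal.ofReal (w z)) := by
    rw [← hfst] at hai
    exact (integrable_map_measure ham.aestronglyMeasurable measurable_fst.aemeasurable).1 hai
  have heI : ∫ z : S × T, -Real.log (qi ρ Q z.1)
      ∂((P.prod Q).withDensity fun z => ENNReal.ofReal (w z)) = ∫ x, -Real.log (qi ρ Q x) ∂P := by
    conv_rhs => rw [← hfst]
    rw [integral_map measurable_fst.aemeasurable ham.aestronglyMeasurable]
  have := R_le_coupling (P := P) (Q := Q) hρm hρ0 hwm hw0 h1 hD h2 hei ?_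
  · refine this.trans ?_
    rw [heI, ENNReal.ofReal_le_iff_le_toReal hK]
    exact haI
  · rw [ae_withDensity_iff hwm.ennreal_ofReal]
    refine Eventually.of_forall fun z hz => ?_
    by_cases hy : ρ z ≤ gi ρ Q z.1
    · simp [hw, indicator, hy]
    · simp [hw, indicator, hy] at hz

theorem ball_boundary (hρ0 : ∀ z, 0 ≤ ρ z) {D : ℝ} {n : ℕ} (hn : 0 < n) (x : ℕ → S)
    (hq : ∀ k, 0 < qi ρ Q (x k)) (hg : ∑ k ∈ Finset.range n, (gi ρ Q (x k) - D) ≤ 0) :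
    LnIID ρ Q D n x ≤
      ENNReal.ofReal ((n : ℝ)⁻¹ * ∑ k ∈ Finset.range n, -Real.log (qi ρ Q (x k))) := by
  have hn' : (0 : ℝ) < n := by exact_mod_cast hn
  unfold LnIID
  rw [← inv_mul_ofReal hn]
  gcongr
  refine negLog_le ?_ prob_le_one
  have hsub : (univ.pi fun k : Fin n => {y | ρ (x k, y) ≤ gi ρ Q (x k)}) ⊆
      {y : Fin n → T | rhoFin ρ n (fun k => x k) y ≤ D} := by
    intro y hy
    change (n : ℝ)⁻¹ * ∑ k : Fin n, ρ (x k, y k) ≤ D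
    rw [inv_mul_le_iff₀ hn']
    rw [Finset.sum_sub_distrib] at hg
    simp only [Finset.sum_const, Finset.card_range, nsmul_eq_mul] at hg
    have h1 : ∑ k : Fin n, ρ (x k, y k) ≤ ∑ k : Fin n, gi ρ Q (x k) :=
      Finset.sum_le_sum fun k _ => hy k (mem_univ k)
    rw [Fin.sum_univ_eq_sum_range (fun k => gi ρ Q (x k)) n] at h1
    linarith
  refine le_trans (le_of_eq ?_) (measure_mono hsub)
  rw [Measure.pi_pi]
  have e : ∀ k : Fin n, Q {y | ρ (x k, y) ≤ gi ρ Q (x k)} =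
      ENNReal.ofReal (Real.exp (Real.log (qi ρ Q (x k)))) := by
    intro k
    rw [Real.exp_log (hq k), qi, ofReal_measureReal]
  rw [Finset.prod_congr rfl fun k _ => e k,
    ← ENNReal.ofReal_prod_of_nonneg (fun _ _ => Real.exp_nonneg _), ← Real.exp_sum,
    Fin.sum_univ_eq_sum_range (fun k => Real.log (qi ρ Q (x k))) n]
  congr 2
  simp

theorem case_boundary (hErg : Ergodic shiftSeq Psrc) (hP1 : Psrc.map (fun x => x 0) = P)
    (hρm : Measurable ρ) (hρ0 : ∀ z, 0 ≤ ρ z) {D : ℝ} (hD : 0 ≤ D) (hK : Kd ρ P Q D ≠ ∞)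
    (hd : ∀ l, 0 < l → D ≤ ∫ x, ml ρ Q l x ∂P) :
    ∀ᵐ x ∂Psrc, liminf (fun n => LnIID ρ Q D n x) atTop ≤ Kd ρ P Q D := by
  obtain ⟨hpos, hai, haI⟩ := qi_fin (P := P) hρm hρ0 hD hK hd
  have hF : Integrable (fl ρ Q 1) P := (Kd_fin (P := P) (Q := Q) hρm hρ0 hK zero_le_one).1
  have hgi := gi_int (P := P) hρm hρ0 hF
  have hgI := gi_integral (P := P) hρm hρ0 hD hK hd
  have hqm := qi_meas (Q := Q) hρm hρ0
  have hfr := src_freq hErg hP1 (f := fun x => gi ρ Q x - D) ((gi_meas hρm hρ0).sub_const D)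
    (hgi.sub (integrable_const D)) (by rw [integral_sub hgi (integrable_const D)]; simp [hgI])
  have hlim := src_limit hErg hP1 (f := fun x => -Real.log (qi ρ Q x)) hqm.log.neg hai
  have hq : ∀ᵐ x ∂Psrc, ∀ k, 0 < qi ρ Q (x k) := by
    rw [ae_all_iff]
    intro k
    have h0 : ∀ᵐ x ∂Psrc, 0 < qi ρ Q (x 0) := by
      rw [← hP1] at hpos
      exact ae_of_ae_map (measurable_pi_apply 0).aemeasurable hpos
    induction k with
    | zero => exact h0
    | succ k ih => exact hErg.toMeasurePreserving.quasiMeasurePreserving.ae ih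
  filter_upwards [hfr, hlim, hq] with x h1 h2 h3
  refine le_of_forall_gt fun c hc => ?_
  obtain ⟨c', hc1, hc2⟩ := exists_between hc
  refine lt_of_le_of_lt ?_ hc2
  refine liminf_le_of_frequently_le' ?_
  have h4 := ENNReal.tendsto_ofReal h2
  have h5 : ENNReal.ofReal (∫ x, -Real.log (qi ρ Q x) ∂P) < c' :=
    ((ENNReal.ofReal_le_iff_le_toReal hK).2 haI).trans_lt hc1
  have h6 := (h4.eventually (gt_mem_nhds h5)).and (eventually_gt_atTop 0)
  refine (h1.and_eventually h6).mono fun n hn => ?_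
  exact (ball_boundary hρ0 hn.2.2 x h3 hn.1).trans hn.2.1.le

end Boundary

/-- generalized AEP, liminf form: for a stationary ergodic source
with one-dimensional marginal `P` and a memoryless codebook distribution `Q`,
`liminf_n L_n(X_1^n, Q^n, D) = R(P,Q,D)` almost surely, for every `D`. -/
theorem stmt8 {S T : Type*} [MeasurableSpace S] [StandardBorelSpace S]
    [MeasurableSpace T] [StandardBorelSpace T]
    (ρ : S × T → ℝ) (hρm : Measurable ρ) (hρ0 : ∀ z, 0 ≤ ρ z)
    (P : Measure S) (Q : Measure T) [IsProbabilityMeasure P] [IsProbabilityMeasure Q]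
    (Psrc : Measure (ℕ → S)) [IsProbabilityMeasure Psrc]
    (hErg : Ergodic shiftSeq Psrc)
    (hP1 : Psrc.map (fun x => x 0) = P) (D : ℝ) :
    ∀ᵐ x ∂Psrc, liminf (fun n => LnIID ρ Q D n x) atTop = Rrate ρ P Q D := by
  rcases lt_or_ge D 0 with hD | hD
  · exact Eventually.of_forall fun x => neg_case hρm hρ0 hD x
  have hlow := liminf_lower (Q := Q) hErg hP1 hρm hρ0 D
  have hKR := Kd_le_R (P := P) (Q := Q) hρm hρ0 D
  by_cases hK : Kd ρ P Q D = ∞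
  · filter_upwards [hlow] with x hx
    rw [hK, top_le_iff] at hx hKR
    rw [hx, hKR]
  have hup : Rrate ρ P Q D ≤ Kd ρ P Q D ∧
      ∀ᵐ x ∂Psrc, liminf (fun n => LnIID ρ Q D n x) atTop ≤ Kd ρ P Q D := by
    by_cases hd : ∃ l₀ : ℝ, 0 < l₀ ∧ ∫ x, ml ρ Q l₀ x ∂P < D
    · obtain ⟨l₀, hl₀, hd⟩ := hd
      exact case_interior hErg hP1 hρm hρ0 hD hK hl₀ hd
    · push Not at hd
      exact ⟨R_le_boundary hρm hρ0 hD hK hd, case_boundary hErg hP1 hρm hρ0 hD hK hd⟩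
  filter_upwards [hlow, hup.2] with x h1 h2
  rw [le_antisymm h2 h1, le_antisymm hup.1 hKR]

end
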